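/- arXiv:2205.13526 — 12 statements merged into one kernel-verified Lean document; each statement's English description precedes it below -/
import Mathlib

section
/- Let α, β, γ, δ, λ₀, λ₁, λ₂, λ₃, σ be real constants with αδ − βγ = 1 and σ ≠ 0. Define x̂(t,x) := x + 3λ₃t² + 2λ₂t + λ₁, ŷ(t,y) := y + λ₃t³ + λ₂t² + λ₁t + λ₀, T(t) := (αt+β)/(γt+δ), X(t,x,y) := x̂(t,x)/(γt+δ) − 3γŷ(t,y)/(γt+δ)², Y(t,y) := ŷ(t,y)/(γt+δ)³, and E(t,x,y) := γx̂(t,x)²/(γt+δ) − 3γ²x̂(t,x)ŷ(t,y)/(γt+δ)² + 3γ³ŷ(t,y)²/(γt+δ)³ + 3λ₃(y − tx) − λ₂x − (3λ₃²t³ + 3λ₃λ₂t² + λ₂²t). If w : ℝ³ → ℝ is a smooth solution of the remarkable Fokker–Planck equation on ℝ³ and f is a smooth solution of it on Ω := {(t,x,y) ∈ ℝ³ : γt + δ ≠ 0}, then the function u(t,x,y) := σ (γt+δ)⁻² exp(−E(t,x,y)) · w(T(t), X(t,x,y), Y(t,y)) + f(t,x,y) is a solution of the remarkable Fokker–Planck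 equation on Ω. -/
/-- ∂_t u -/
noncomputable def dT (u : ℝ → ℝ → ℝ → ℝ) (t x y : ℝ) : ℝ := deriv (fun s => u s x y) t
/-- ∂_y u -/
noncomputable def dY (u : ℝ → ℝ → ℝ → ℝ) (t x y : ℝ) : ℝ := deriv (fun s => u t x s) y
/-- ∂²_x u -/
noncomputable def dXX (u : ℝ → ℝ → ℝ → ℝ) (t x y : ℝ) : ℝ := deriv (deriv (fun s => u t s y)) x

/-- The transformed function of Theorem 2 of the paper. -/
noncomputable def sol0 (α β γ δ l0 l1 l2 l3 σ : ℝ) (w f : ℝ → ℝ → ℝ → ℝ)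
    (t x y : ℝ) : ℝ :=
  let xh : ℝ := x + 3 * l3 * t ^ 2 + 2 * l2 * t + l1
  let yh : ℝ := y + l3 * t ^ 3 + l2 * t ^ 2 + l1 * t + l0
  let E : ℝ := γ * xh ^ 2 / (γ * t + δ) - 3 * γ ^ 2 * xh * yh / (γ * t + δ) ^ 2
      + 3 * γ ^ 3 * yh ^ 2 / (γ * t + δ) ^ 3
      + 3 * l3 * (y - t * x) - l2 * x
      - (3 * l3 ^ 2 * t ^ 3 + 3 * l3 * l2 * t ^ 2 + l2 ^ 2 * t)
  σ * ((γ * t + δ) ^ 2)⁻¹ * Real.exp (-E) *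
    w ((α * t + β) / (γ * t + δ))
      (xh / (γ * t + δ) - 3 * γ * yh / (γ * t + δ) ^ 2)
      (yh / (γ * t + δ) ^ 3)
  + f t x y

/-- The Galilean-type shift of the variable `x`. -/
noncomputable def xHat (l1 l2 l3 t x : ℝ) : ℝ := x + 3 * l3 * t ^ 2 + 2 * l2 * t + l1

/-- The Galilean-type shift of the variable `y`. -/
noncomputable def yHat (l0 l1 l2 l3 t y : ℝ) : ℝ := y + l3 * t ^ 3 + l2 * t ^ 2 + l1 * t + l0

/-- The exponent (up to sign) in the multiplier of the point symmetry. -/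
noncomputable def symExponent (γ δ l0 l1 l2 l3 t x y : ℝ) : ℝ :=
  γ * xHat l1 l2 l3 t x ^ 2 / (γ * t + δ)
    - 3 * γ ^ 2 * xHat l1 l2 l3 t x * yHat l0 l1 l2 l3 t y / (γ * t + δ) ^ 2
    + 3 * γ ^ 3 * yHat l0 l1 l2 l3 t y ^ 2 / (γ * t + δ) ^ 3
    + 3 * l3 * (y - t * x) - l2 * x
    - (3 * l3 ^ 2 * t ^ 3 + 3 * l3 * l2 * t ^ 2 + l2 ^ 2 * t)

/-- The new time variable. -/
noncomputable def symT (α β γ δ t : ℝ) : ℝ := (α * t + β) / (γ * t + δ)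

/-- The new variable `x`. -/
noncomputable def symX (γ δ l0 l1 l2 l3 t x y : ℝ) : ℝ :=
  xHat l1 l2 l3 t x / (γ * t + δ) - 3 * γ * yHat l0 l1 l2 l3 t y / (γ * t + δ) ^ 2

/-- The new variable `y`. -/
noncomputable def symY (γ δ l0 l1 l2 l3 t y : ℝ) : ℝ :=
  yHat l0 l1 l2 l3 t y / (γ * t + δ) ^ 3

/-- The multiplier of the point symmetry. -/
noncomputable def symFactor (γ δ l0 l1 l2 l3 σ t x y : ℝ) : ℝ :=
  σ * ((γ * t + δ) ^ 2)⁻¹ * Real.exp (-symExponent γ δ l0 l1 l2 l3 t x y)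

theorem sol0_eq (α β γ δ l0 l1 l2 l3 σ : ℝ) (w f : ℝ → ℝ → ℝ → ℝ) (t x y : ℝ) :
    sol0 α β γ δ l0 l1 l2 l3 σ w f t x y =
      symFactor γ δ l0 l1 l2 l3 σ t x y *
        w (symT α β γ δ t) (symX γ δ l0 l1 l2 l3 t x y) (symY γ δ l0 l1 l2 l3 t y)
      + f t x y := rfl

section Curves

variable {α β γ δ l0 l1 l2 l3 σ : ℝ} {a b c : ℝ → ℝ} {a' b' c' r : ℝ}

theorem hasDerivAt_xHat (ha : HasDerivAt a a' r) (hb : HasDerivAt b b' r) :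
    HasDerivAt (fun s => xHat l1 l2 l3 (a s) (b s)) (b' + (6 * l3 * a r + 2 * l2) * a') r := by
  unfold xHat
  refine HasDerivAt.congr_deriv (((hb.fun_add ((ha.fun_pow 2).const_mul (3 * l3))).fun_add (ha.const_mul (2 * l2))).add_const l1) ?_
  push_cast; ring

theorem hasDerivAt_yHat (ha : HasDerivAt a a' r) (hc : HasDerivAt c c' r) :
    HasDerivAt (fun s => yHat l0 l1 l2 l3 (a s) (c s))
      (c' + (3 * l3 * a r ^ 2 + 2 * l2 * a r + l1) * a') r := by
  unfold yHat
  refine HasDerivAt.congr_deriv ((((hc.fun_add ((ha.fun_pow 3).const_mul l3)).fun_add ((ha.fun_pow 2).const_mul l2)).fun_add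
    (ha.const_mul l1)).add_const l0) ?_
  push_cast; ring

theorem hasDerivAt_affine (ha : HasDerivAt a a' r) :
    HasDerivAt (fun s => γ * a s + δ) (γ * a') r :=
  (ha.const_mul γ).add_const δ

theorem hasDerivAt_symT (hdet : α * δ - β * γ = 1) (h0 : γ * a r + δ ≠ 0)
    (ha : HasDerivAt a a' r) :
    HasDerivAt (fun s => symT α β γ δ (a s)) (a' / (γ * a r + δ) ^ 2) r := by
  unfold symT
  refine HasDerivAt.congr_deriv ((hasDerivAt_affine ha).fun_div (hasDerivAt_affine ha) h0) ?_
  congr 1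
  linear_combination a' * hdet

theorem hasDerivAt_symX (h0 : γ * a r + δ ≠ 0)
    (ha : HasDerivAt a a' r) (hb : HasDerivAt b b' r) (hc : HasDerivAt c c' r) :
    HasDerivAt (fun s => symX γ δ l0 l1 l2 l3 (a s) (b s) (c s))
      ((b' + (6 * l3 * a r + 2 * l2) * a') / (γ * a r + δ)
        - γ * xHat l1 l2 l3 (a r) (b r) * a' / (γ * a r + δ) ^ 2
        - 3 * γ * (c' + (3 * l3 * a r ^ 2 + 2 * l2 * a r + l1) * a') / (γ * a r + δ) ^ 2
        + 6 * γ ^ 2 * yHat l0 l1 l2 l3 (a r) (c r) * a' / (γ * a r + δ) ^ 3) r := by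
  unfold symX
  have hs := hasDerivAt_affine (γ := γ) (δ := δ) ha
  have hx := hasDerivAt_xHat (l1 := l1) (l2 := l2) (l3 := l3) ha hb
  have hy := hasDerivAt_yHat (l0 := l0) (l1 := l1) (l2 := l2) (l3 := l3) ha hc
  refine HasDerivAt.congr_deriv ((hx.fun_div hs h0).fun_sub
    ((hy.const_mul (3 * γ)).fun_div (hs.fun_pow 2) (pow_ne_zero 2 h0))) ?_
  simp only [Nat.cast_ofNat, Nat.reduceSub, pow_one]
  generalize γ * a r + δ = S at h0 ⊢
  generalize xHat l1 l2 l3 (a r) (b r) = p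
  generalize yHat l0 l1 l2 l3 (a r) (c r) = q
  field_simp
  ring

theorem hasDerivAt_symY (h0 : γ * a r + δ ≠ 0)
    (ha : HasDerivAt a a' r) (hc : HasDerivAt c c' r) :
    HasDerivAt (fun s => symY γ δ l0 l1 l2 l3 (a s) (c s))
      ((c' + (3 * l3 * a r ^ 2 + 2 * l2 * a r + l1) * a') / (γ * a r + δ) ^ 3
        - 3 * γ * yHat l0 l1 l2 l3 (a r) (c r) * a' / (γ * a r + δ) ^ 4) r := by
  unfold symY
  have hs := hasDerivAt_affine (γ := γ) (δ := δ) ha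
  have hy := hasDerivAt_yHat (l0 := l0) (l1 := l1) (l2 := l2) (l3 := l3) ha hc
  refine HasDerivAt.congr_deriv (hy.fun_div (hs.fun_pow 3) (pow_ne_zero 3 h0)) ?_
  simp only [Nat.cast_ofNat, Nat.reduceSub]
  generalize γ * a r + δ = S at h0 ⊢
  generalize yHat l0 l1 l2 l3 (a r) (c r) = q
  field_simp

theorem hasDerivAt_symExponent (h0 : γ * a r + δ ≠ 0)
    (ha : HasDerivAt a a' r) (hb : HasDerivAt b b' r) (hc : HasDerivAt c c' r) :
    HasDerivAt (fun s => symExponent γ δ l0 l1 l2 l3 (a s) (b s) (c s))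
      (2 * γ * xHat l1 l2 l3 (a r) (b r) * (b' + (6 * l3 * a r + 2 * l2) * a') / (γ * a r + δ)
        - γ ^ 2 * xHat l1 l2 l3 (a r) (b r) ^ 2 * a' / (γ * a r + δ) ^ 2
        - 3 * γ ^ 2 * ((b' + (6 * l3 * a r + 2 * l2) * a') * yHat l0 l1 l2 l3 (a r) (c r)
          + xHat l1 l2 l3 (a r) (b r) * (c' + (3 * l3 * a r ^ 2 + 2 * l2 * a r + l1) * a'))
          / (γ * a r + δ) ^ 2
        + 6 * γ ^ 3 * xHat l1 l2 l3 (a r) (b r) * yHat l0 l1 l2 l3 (a r) (c r) * a'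
          / (γ * a r + δ) ^ 3
        + 6 * γ ^ 3 * yHat l0 l1 l2 l3 (a r) (c r)
          * (c' + (3 * l3 * a r ^ 2 + 2 * l2 * a r + l1) * a') / (γ * a r + δ) ^ 3
        - 9 * γ ^ 4 * yHat l0 l1 l2 l3 (a r) (c r) ^ 2 * a' / (γ * a r + δ) ^ 4
        + 3 * l3 * (c' - a' * b r - a r * b') - l2 * b'
        - (9 * l3 ^ 2 * a r ^ 2 + 6 * l3 * l2 * a r + l2 ^ 2) * a') r := by
  unfold symExponent
  have hs := hasDerivAt_affine (γ := γ) (δ := δ) ha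
  have hx := hasDerivAt_xHat (l1 := l1) (l2 := l2) (l3 := l3) ha hb
  have hy := hasDerivAt_yHat (l0 := l0) (l1 := l1) (l2 := l2) (l3 := l3) ha hc
  refine HasDerivAt.congr_deriv ((((((((hx.fun_pow 2).const_mul γ).fun_div hs h0).fun_sub
      (((hx.const_mul (3 * γ ^ 2)).fun_mul hy).fun_div (hs.fun_pow 2) (pow_ne_zero 2 h0))).fun_add
      (((hy.fun_pow 2).const_mul (3 * γ ^ 3)).fun_div (hs.fun_pow 3) (pow_ne_zero 3 h0))).fun_add
      ((hc.fun_sub (ha.fun_mul hb)).const_mul (3 * l3))).fun_sub (hb.const_mul l2)).fun_sub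
      ((((ha.fun_pow 3).const_mul (3 * l3 ^ 2)).fun_add
        ((ha.fun_pow 2).const_mul (3 * l3 * l2))).fun_add (ha.const_mul (l2 ^ 2)))) ?_
  simp only [Nat.cast_ofNat, Nat.reduceSub, pow_one]
  generalize γ * a r + δ = S at h0 ⊢
  generalize xHat l1 l2 l3 (a r) (b r) = p
  generalize yHat l0 l1 l2 l3 (a r) (c r) = q
  field_simp
  ring

theorem hasDerivAt_symFactor {E' : ℝ} (h0 : γ * a r + δ ≠ 0) (ha : HasDerivAt a a' r)
    (hE : HasDerivAt (fun s => symExponent γ δ l0 l1 l2 l3 (a s) (b s) (c s)) E' r) :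
    HasDerivAt (fun s => symFactor γ δ l0 l1 l2 l3 σ (a s) (b s) (c s))
      (symFactor γ δ l0 l1 l2 l3 σ (a r) (b r) (c r) *
        (-(2 * γ * a' / (γ * a r + δ)) - E')) r := by
  unfold symFactor
  refine HasDerivAt.congr_deriv (((((hasDerivAt_affine (γ := γ) (δ := δ) ha).fun_pow 2).fun_inv
    (pow_ne_zero 2 h0)).const_mul σ).fun_mul hE.fun_neg.exp) ?_
  simp only [Nat.cast_ofNat, Nat.reduceSub, pow_one]
  generalize γ * a r + δ = S at h0 ⊢
  field_simp
  ring

/-- Chain rule along a curve in `ℝ³`, for curried functions. -/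
theorem hasDerivAt_curry_comp {w : ℝ → ℝ → ℝ → ℝ}
    (hw : DifferentiableAt ℝ (fun p : ℝ × ℝ × ℝ => w p.1 p.2.1 p.2.2) (a r, b r, c r))
    (ha : HasDerivAt a a' r) (hb : HasDerivAt b b' r) (hc : HasDerivAt c c' r) :
    HasDerivAt (fun s => w (a s) (b s) (c s))
      (a' * deriv (fun s => w s (b r) (c r)) (a r)
        + b' * deriv (fun s => w (a r) s (c r)) (b r)
        + c' * deriv (fun s => w (a r) (b r) s) (c r)) r := by
  have key : ∀ {a b c : ℝ → ℝ} {a' b' c' r : ℝ} {q : ℝ × ℝ × ℝ}, (a r, b r, c r) = q →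
      DifferentiableAt ℝ (fun p : ℝ × ℝ × ℝ => w p.1 p.2.1 p.2.2) q →
      HasDerivAt a a' r → HasDerivAt b b' r → HasDerivAt c c' r →
      HasDerivAt (fun s => w (a s) (b s) (c s))
        (fderiv ℝ (fun p : ℝ × ℝ × ℝ => w p.1 p.2.1 p.2.2) q (a', b', c')) r := by
    intro a b c a' b' c' r q hq hd ha hb hc
    subst hq
    exact hd.hasFDerivAt.comp_hasDerivAt (f := fun s => (a s, b s, c s)) r
      (ha.prodMk (hb.prodMk hc))
  refine HasDerivAt.congr_deriv (key rfl hw ha hb hc) ?_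
  rw [(key (a := fun s => s) (b := fun _ => b r) (c := fun _ => c r) rfl hw
      (hasDerivAt_id _) (hasDerivAt_const _ _) (hasDerivAt_const _ _)).deriv,
    (key (a := fun _ => a r) (b := fun s => s) (c := fun _ => c r) rfl hw
      (hasDerivAt_const _ _) (hasDerivAt_id _) (hasDerivAt_const _ _)).deriv,
    (key (a := fun _ => a r) (b := fun _ => b r) (c := fun s => s) rfl hw
      (hasDerivAt_const _ _) (hasDerivAt_const _ _) (hasDerivAt_id _)).deriv]
  simp only [← smul_eq_mul, ← map_smul, ← map_add]
  simp

end Curves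

/-- The partial derivative in `x` of a smooth function is smooth. -/
theorem contDiff_deriv_middle {w : ℝ → ℝ → ℝ → ℝ}
    (hw : ContDiff ℝ (⊤ : ℕ∞) (fun p : ℝ × ℝ × ℝ => w p.1 p.2.1 p.2.2)) :
    ContDiff ℝ (⊤ : ℕ∞)
      (fun p : ℝ × ℝ × ℝ => deriv (fun s => w p.1 s p.2.2) p.2.1) := by
  have h : (fun p : ℝ × ℝ × ℝ => deriv (fun s => w p.1 s p.2.2) p.2.1) =
      fun p => fderiv ℝ (fun p : ℝ × ℝ × ℝ => w p.1 p.2.1 p.2.2) p (0, 1, 0) := by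
    funext p
    exact ((hw.differentiable (by simp) p).hasFDerivAt.comp_hasDerivAt
      (f := fun s => (p.1, s, p.2.2)) p.2.1 ((hasDerivAt_const _ _).prodMk
        ((hasDerivAt_id _).prodMk (hasDerivAt_const _ _)))).deriv
  rw [h]
  exact (hw.fderiv_right (m := (⊤ : ℕ∞)) (by simp)).clm_apply contDiff_const

theorem contDiffOn_sol0 (α β γ δ l0 l1 l2 l3 σ : ℝ) {w f : ℝ → ℝ → ℝ → ℝ}
    (hw : ContDiff ℝ 2 (fun p : ℝ × ℝ × ℝ => w p.1 p.2.1 p.2.2))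
    (hf : ContDiffOn ℝ 2 (fun p : ℝ × ℝ × ℝ => f p.1 p.2.1 p.2.2)
      {p : ℝ × ℝ × ℝ | γ * p.1 + δ ≠ 0}) :
    ContDiffOn ℝ 2
      (fun p : ℝ × ℝ × ℝ => sol0 α β γ δ l0 l1 l2 l3 σ w f p.1 p.2.1 p.2.2)
      {p : ℝ × ℝ × ℝ | γ * p.1 + δ ≠ 0} := by
  have hs : ContDiffOn ℝ 2 (fun p : ℝ × ℝ × ℝ => γ * p.1 + δ)
      {p : ℝ × ℝ × ℝ | γ * p.1 + δ ≠ 0} := by fun_prop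
  have h1 : ∀ p ∈ {p : ℝ × ℝ × ℝ | γ * p.1 + δ ≠ 0}, γ * p.1 + δ ≠ 0 := fun p hp => hp
  have h2 : ∀ n : ℕ, ∀ p ∈ {p : ℝ × ℝ × ℝ | γ * p.1 + δ ≠ 0}, (γ * p.1 + δ) ^ n ≠ 0 :=
    fun n p hp => pow_ne_zero n hp
  have hx : ContDiffOn ℝ 2 (fun p : ℝ × ℝ × ℝ => xHat l1 l2 l3 p.1 p.2.1)
      {p : ℝ × ℝ × ℝ | γ * p.1 + δ ≠ 0} := by unfold xHat; fun_prop
  have hy : ContDiffOn ℝ 2 (fun p : ℝ × ℝ × ℝ => yHat l0 l1 l2 l3 p.1 p.2.2)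
      {p : ℝ × ℝ × ℝ | γ * p.1 + δ ≠ 0} := by unfold yHat; fun_prop
  have hE : ContDiffOn ℝ 2 (fun p : ℝ × ℝ × ℝ => symExponent γ δ l0 l1 l2 l3 p.1 p.2.1 p.2.2)
      {p : ℝ × ℝ × ℝ | γ * p.1 + δ ≠ 0} := by
    unfold symExponent
    fun_prop (disch := first | exact h1 | exact h2 _)
  have hT : ContDiffOn ℝ 2 (fun p : ℝ × ℝ × ℝ => symT α β γ δ p.1)
      {p : ℝ × ℝ × ℝ | γ * p.1 + δ ≠ 0} := by
    unfold symT
    fun_prop (disch := first | exact h1 | exact h2 _)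
  have hX : ContDiffOn ℝ 2 (fun p : ℝ × ℝ × ℝ => symX γ δ l0 l1 l2 l3 p.1 p.2.1 p.2.2)
      {p : ℝ × ℝ × ℝ | γ * p.1 + δ ≠ 0} := by
    unfold symX
    fun_prop (disch := first | exact h1 | exact h2 _)
  have hY : ContDiffOn ℝ 2 (fun p : ℝ × ℝ × ℝ => symY γ δ l0 l1 l2 l3 p.1 p.2.2)
      {p : ℝ × ℝ × ℝ | γ * p.1 + δ ≠ 0} := by
    unfold symY
    fun_prop (disch := first | exact h1 | exact h2 _)
  have hk : ContDiffOn ℝ 2 (fun p : ℝ × ℝ × ℝ => symFactor γ δ l0 l1 l2 l3 σ p.1 p.2.1 p.2.2)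
      {p : ℝ × ℝ × ℝ | γ * p.1 + δ ≠ 0} := by
    unfold symFactor
    exact (contDiffOn_const.mul ((hs.pow 2).inv (h2 2))).mul hE.neg.exp
  exact (hk.mul (hw.comp_contDiffOn (hT.prodMk (hX.prodMk hY)))).add hf


theorem point_symmetry_of_remarkable_FP
    (α β γ δ l0 l1 l2 l3 σ : ℝ)
    (hdet : α * δ - β * γ = 1) (hσ : σ ≠ 0)
    (w f : ℝ → ℝ → ℝ → ℝ)
    (hw : ContDiff ℝ (⊤ : ℕ∞) (fun p : ℝ × ℝ × ℝ => w p.1 p.2.1 p.2.2))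
    (hwsol : ∀ t x y : ℝ, dT w t x y + x * dY w t x y = dXX w t x y)
    (hf : ContDiffOn ℝ (⊤ : ℕ∞) (fun p : ℝ × ℝ × ℝ => f p.1 p.2.1 p.2.2)
      {p : ℝ × ℝ × ℝ | γ * p.1 + δ ≠ 0})
    (hfsol : ∀ t x y : ℝ, γ * t + δ ≠ 0 →
      dT f t x y + x * dY f t x y = dXX f t x y) :
    ContDiffOn ℝ 2
      (fun p : ℝ × ℝ × ℝ => sol0 α β γ δ l0 l1 l2 l3 σ w f p.1 p.2.1 p.2.2)
      {p : ℝ × ℝ × ℝ | γ * p.1 + δ ≠ 0} ∧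
    ∀ t x y : ℝ, γ * t + δ ≠ 0 →
      dT (sol0 α β γ δ l0 l1 l2 l3 σ w f) t x y
        + x * dY (sol0 α β γ δ l0 l1 l2 l3 σ w f) t x y
        = dXX (sol0 α β γ δ l0 l1 l2 l3 σ w f) t x y := by
  have h2top : (2 : WithTop ℕ∞) ≤ ((⊤ : ℕ∞) : WithTop ℕ∞) := by
    exact WithTop.coe_le_coe.2 (le_top : (2 : ℕ∞) ≤ ⊤)
  refine ⟨contDiffOn_sol0 α β γ δ l0 l1 l2 l3 σ (hw.of_le h2top) (hf.of_le h2top), ?_⟩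
  intro t x y h0
  have hopen : IsOpen {p : ℝ × ℝ × ℝ | γ * p.1 + δ ≠ 0} :=
    isOpen_ne_fun (by fun_prop) continuous_const
  have hfd : ∀ x, DifferentiableAt ℝ (fun p : ℝ × ℝ × ℝ => f p.1 p.2.1 p.2.2) (t, x, y) :=
    fun x => (hf.contDiffAt (hopen.mem_nhds h0)).differentiableAt (by simp)
  have hfx : ContDiff ℝ (⊤ : ℕ∞) (fun s => f t s y) :=
    contDiffOn_univ.1 (hf.comp (f := fun s : ℝ => (t, s, y)) (by fun_prop) fun s _ => h0)
  have hft : DifferentiableAt ℝ (fun s => f s x y) t :=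
    (hfd x).comp t (f := fun s : ℝ => (s, x, y)) (by fun_prop)
  have hfy : DifferentiableAt ℝ (fun s => f t x s) y :=
    (hfd x).comp y (f := fun s : ℝ => (t, x, s)) (by fun_prop)
  have hfxx : DifferentiableAt ℝ (deriv fun s => f t s y) x :=
    (hfx.of_le h2top).differentiable_deriv_two x
  have hwd := hw.differentiable (by simp)
  have hwxd := (contDiff_deriv_middle hw).differentiable (by simp)
  have hx0 (x : ℝ) := hasDerivAt_const x t
  have hx1 (x : ℝ) := hasDerivAt_id' x
  have hx2 (x : ℝ) := hasDerivAt_const x y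
  have hDt := ((hasDerivAt_symFactor (σ := σ) h0 (hasDerivAt_id' t)
    (hasDerivAt_symExponent (l0 := l0) (l1 := l1) (l2 := l2) (l3 := l3) h0 (hasDerivAt_id' t)
      (hasDerivAt_const t x) (hasDerivAt_const t y))).fun_mul
    (hasDerivAt_curry_comp (hwd _) (hasDerivAt_symT hdet h0 (hasDerivAt_id' t))
      (hasDerivAt_symX (l0 := l0) (l1 := l1) (l2 := l2) (l3 := l3) h0 (hasDerivAt_id' t)
        (hasDerivAt_const t x) (hasDerivAt_const t y))
      (hasDerivAt_symY (l0 := l0) (l1 := l1) (l2 := l2) (l3 := l3) h0 (hasDerivAt_id' t)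
        (hasDerivAt_const t y)))).fun_add hft.hasDerivAt
  have hDy := ((hasDerivAt_symFactor (σ := σ) h0 (hasDerivAt_const y t)
    (hasDerivAt_symExponent (l0 := l0) (l1 := l1) (l2 := l2) (l3 := l3) h0 (hasDerivAt_const y t)
      (hasDerivAt_const y x) (hasDerivAt_id' y))).fun_mul
    (hasDerivAt_curry_comp (hwd _) (hasDerivAt_symT hdet h0 (hasDerivAt_const y t))
      (hasDerivAt_symX (l0 := l0) (l1 := l1) (l2 := l2) (l3 := l3) h0 (hasDerivAt_const y t)
        (hasDerivAt_const y x) (hasDerivAt_id' y))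
      (hasDerivAt_symY (l0 := l0) (l1 := l1) (l2 := l2) (l3 := l3) h0 (hasDerivAt_const y t)
        (hasDerivAt_id' y)))).fun_add hfy.hasDerivAt
  have hE (x : ℝ) : HasDerivAt (fun s => symExponent γ δ l0 l1 l2 l3 t s y)
      (2 * γ * xHat l1 l2 l3 t x / (γ * t + δ)
        - 3 * γ ^ 2 * yHat l0 l1 l2 l3 t y / (γ * t + δ) ^ 2 - 3 * l3 * t - l2) x := by
    refine HasDerivAt.congr_deriv (hasDerivAt_symExponent h0 (hx0 x) (hx1 x) (hx2 x)) ?_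
    ring
  have hEx : HasDerivAt (fun x => 2 * γ * xHat l1 l2 l3 t x / (γ * t + δ)
        - 3 * γ ^ 2 * yHat l0 l1 l2 l3 t y / (γ * t + δ) ^ 2 - 3 * l3 * t - l2)
      (2 * γ / (γ * t + δ)) x := by
    refine HasDerivAt.congr_deriv ((((((hasDerivAt_xHat (hx0 x) (hx1 x)).const_mul (2 * γ)).div_const
      (γ * t + δ)).sub_const _).sub_const _).sub_const _) ?_
    ring
  have hk (x : ℝ) := hasDerivAt_symFactor (σ := σ) h0 (hx0 x) (hE x)
  have hT (x : ℝ) : HasDerivAt (fun _ => symT α β γ δ t) 0 x := hasDerivAt_const _ _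
  have hX (x : ℝ) : HasDerivAt (fun s => symX γ δ l0 l1 l2 l3 t s y) (1 / (γ * t + δ)) x := by
    refine HasDerivAt.congr_deriv (hasDerivAt_symX h0 (hx0 x) (hx1 x) (hx2 x)) ?_
    ring
  have hY (x : ℝ) : HasDerivAt (fun _ => symY γ δ l0 l1 l2 l3 t y) 0 x := hasDerivAt_const _ _
  have hDx (x : ℝ) := ((hk x).fun_mul
    (hasDerivAt_curry_comp (hwd _) (hT x) (hX x) (hY x))).fun_add
      (hfx.differentiable (by simp) x).hasDerivAt
  have hDx' : (deriv fun s => sol0 α β γ δ l0 l1 l2 l3 σ w f t s y) = fun x =>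
      symFactor γ δ l0 l1 l2 l3 σ t x y *
        (-(2 * γ * xHat l1 l2 l3 t x / (γ * t + δ)
          - 3 * γ ^ 2 * yHat l0 l1 l2 l3 t y / (γ * t + δ) ^ 2 - 3 * l3 * t - l2) *
          w (symT α β γ δ t) (symX γ δ l0 l1 l2 l3 t x y) (symY γ δ l0 l1 l2 l3 t y)
        + 1 / (γ * t + δ) *
          deriv (fun s => w (symT α β γ δ t) s (symY γ δ l0 l1 l2 l3 t y))
            (symX γ δ l0 l1 l2 l3 t x y))
      + deriv (fun s => f t s y) x := by
    funext x
    refine (hDx x).deriv.trans ?_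
    ring
  have hDxx := ((hk x).fun_mul ((hEx.fun_neg.fun_mul
    (hasDerivAt_curry_comp (hwd _) (hT x) (hX x) (hY x))).fun_add
    ((hasDerivAt_curry_comp (w := fun t x y => deriv (fun s => w t s y) x)
      (hwxd _) (hT x) (hX x) (hY x)).const_mul (1 / (γ * t + δ))))).fun_add hfxx.hasDerivAt
  have hweq := hwsol (symT α β γ δ t) (symX γ δ l0 l1 l2 l3 t x y) (symY γ δ l0 l1 l2 l3 t y)
  have hfeq := hfsol t x y h0
  simp only [dT, dY, dXX] at hweq hfeq ⊢
  rw [hDx']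
  simp only [sol0_eq]
  rw [hDt.deriv, hDy.deriv, hDxx.deriv]
  rw [← sub_eq_zero] at hfeq ⊢
  generalize symFactor γ δ l0 l1 l2 l3 σ t x y = k
  have hX' : symX γ δ l0 l1 l2 l3 t x y = xHat l1 l2 l3 t x / (γ * t + δ)
    - 3 * γ * yHat l0 l1 l2 l3 t y / (γ * t + δ) ^ 2 := rfl
  have hx' : x = xHat l1 l2 l3 t x - 3 * l3 * t ^ 2 - 2 * l2 * t - l1 := by
    unfold xHat
    ring
  generalize symX γ δ l0 l1 l2 l3 t x y = X at hweq hX' ⊢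
  generalize symY γ δ l0 l1 l2 l3 t y = Y at hweq ⊢
  generalize symT α β γ δ t = T at hweq ⊢
  generalize xHat l1 l2 l3 t x = p at hX' hx' ⊢
  generalize yHat l0 l1 l2 l3 t y = q at hX' ⊢
  generalize γ * t + δ = S at hX' ⊢
  generalize deriv (fun s => f s x y) t = ft at hfeq ⊢
  generalize deriv (fun s => f t x s) y = fy at hfeq ⊢
  generalize deriv (deriv fun s => f t s y) x = fxx at hfeq ⊢
  generalize deriv (fun s => w s X Y) T = wt at hweq ⊢
  generalize deriv (fun s => w T X s) Y = wy at hweq ⊢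
  change _ = deriv (fun s => deriv (fun s => w T s Y) s) X at hweq
  generalize deriv (fun s => deriv (fun s => w T s Y) s) X = wxx at hweq ⊢
  generalize deriv (fun s => w T s Y) X = wx
  generalize w T X Y = w₀
  rw [hX'] at hweq
  rw [hx'] at hfeq ⊢
  linear_combination hfeq + k / S ^ 2 * hweq
end

section
/- Define the following first-order differential operators acting on smooth functions F : ℝ⁴ → ℝ of the variables (t,x,y,u): 𝒫ᵗF = ∂_t F; 𝒟F = 2t∂_tF + x∂_xF + 3y∂_yF − 2u∂_uF; 𝒦F = t²∂_tF + (tx+3y)∂_xF + 3ty∂_yF − (x²+2t)u∂_uF; 𝒫³F = 3t²∂_xF + t³∂_yF + 3(y−tx)u∂_uF; 𝒫²F = 2t∂_xF + t²∂_yF − xu∂_uF; 𝒫¹F = ∂_xF + t∂_yF; 𝒫⁰F = ∂_yF; ℐF = u∂_uF. Then for every twice continuously differentiable F : ℝ⁴ → ℝ the following commutation relations hold pointwise: 𝒫ᵗ(𝒟F) − 𝒟(𝒫ᵗF) = 2𝒫ᵗF; 𝒫ᵗ(𝒦F) − 𝒦(𝒫ᵗF) = 𝒟F; 𝒟(𝒦F)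 − 𝒦(𝒟F) = 2𝒦F; 𝒫¹(𝒫²F) − 𝒫²(𝒫¹F) = −ℐF; 𝒫⁰(𝒫³F) − 𝒫³(𝒫⁰F) = 3ℐF. -/
noncomputable section

/-- ∂_t F for F = F(t,x,y,u). -/
def pdt (F : ℝ → ℝ → ℝ → ℝ → ℝ) (t x y u : ℝ) : ℝ := deriv (fun s => F s x y u) t
/-- ∂_x F. -/
def pdx (F : ℝ → ℝ → ℝ → ℝ → ℝ) (t x y u : ℝ) : ℝ := deriv (fun s => F t s y u) x
/-- ∂_y F. -/
def pdy (F : ℝ → ℝ → ℝ → ℝ → ℝ) (t x y u : ℝ) : ℝ := deriv (fun s => F t x s u) y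
/-- ∂_u F. -/
def pdu (F : ℝ → ℝ → ℝ → ℝ → ℝ) (t x y u : ℝ) : ℝ := deriv (fun s => F t x y s) u

/-- 𝒫ᵗ -/
def opPt (F : ℝ → ℝ → ℝ → ℝ → ℝ) (t x y u : ℝ) : ℝ := pdt F t x y u
/-- 𝒟 -/
def opD (F : ℝ → ℝ → ℝ → ℝ → ℝ) (t x y u : ℝ) : ℝ :=
  2 * t * pdt F t x y u + x * pdx F t x y u + 3 * y * pdy F t x y u - 2 * u * pdu F t x y u
/-- 𝒦 -/
def opK (F : ℝ → ℝ → ℝ → ℝ → ℝ) (t x y u : ℝ) : ℝ :=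
  t ^ 2 * pdt F t x y u + (t * x + 3 * y) * pdx F t x y u + 3 * t * y * pdy F t x y u
    - (x ^ 2 + 2 * t) * u * pdu F t x y u
/-- 𝒫³ -/
def opP3 (F : ℝ → ℝ → ℝ → ℝ → ℝ) (t x y u : ℝ) : ℝ :=
  3 * t ^ 2 * pdx F t x y u + t ^ 3 * pdy F t x y u + 3 * (y - t * x) * u * pdu F t x y u
/-- 𝒫² -/
def opP2 (F : ℝ → ℝ → ℝ → ℝ → ℝ) (t x y u : ℝ) : ℝ :=
  2 * t * pdx F t x y u + t ^ 2 * pdy F t x y u - x * u * pdu F t x y u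
/-- 𝒫¹ -/
def opP1 (F : ℝ → ℝ → ℝ → ℝ → ℝ) (t x y u : ℝ) : ℝ :=
  pdx F t x y u + t * pdy F t x y u
/-- 𝒫⁰ -/
def opP0 (F : ℝ → ℝ → ℝ → ℝ → ℝ) (t x y u : ℝ) : ℝ := pdy F t x y u
/-- ℐ -/
def opI (F : ℝ → ℝ → ℝ → ℝ → ℝ) (t x y u : ℝ) : ℝ := u * pdu F t x y u

/-- A function of four real variables as a function on the product space. -/
def uncurry₄ (F : ℝ → ℝ → ℝ → ℝ → ℝ) (p : ℝ × ℝ × ℝ × ℝ) : ℝ := F p.1 p.2.1 p.2.2.1 p.2.2.2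

/-- The first-order operator `A` acts on differentiable functions as the derivative along `V`. -/
def ActsAs (A : (ℝ → ℝ → ℝ → ℝ → ℝ) → ℝ → ℝ → ℝ → ℝ → ℝ)
    (V : ℝ × ℝ × ℝ × ℝ → ℝ × ℝ × ℝ × ℝ) : Prop :=
  ∀ F, Differentiable ℝ (uncurry₄ F) →
    ∀ p : ℝ × ℝ × ℝ × ℝ, uncurry₄ (A F) p = fderiv ℝ (uncurry₄ F) p (V p)

/-- The commutator of the derivatives along two vector fields is the derivative along their
Lie bracket. -/
theorem fderiv_fderiv_apply_sub_eq_lieBracket {E : Type*} [NormedAddCommGroup E] [NormedSpace ℝ E]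
    {G : E → ℝ} (hG : ContDiff ℝ 2 G) {V W : E → E} (hV : Differentiable ℝ V)
    (hW : Differentiable ℝ W) (p : E) :
    fderiv ℝ (fun q => fderiv ℝ G q (W q)) p (V p)
      - fderiv ℝ (fun q => fderiv ℝ G q (V q)) p (W p)
      = fderiv ℝ G p (VectorField.lieBracket ℝ V W p) := by
  have hd : DifferentiableAt ℝ (fderiv ℝ G) p :=
    (hG.fderiv_right (m := 1) (by norm_num)).differentiable (by norm_num) p
  have hs : IsSymmSndFDerivAt ℝ G p := hG.contDiffAt.isSymmSndFDerivAt (by simp)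
  rw [fderiv_clm_apply hd (hW p), fderiv_clm_apply hd (hV p), VectorField.lieBracket]
  simp [hs.eq (V p) (W p)]

theorem ActsAs.commutator {A B : (ℝ → ℝ → ℝ → ℝ → ℝ) → ℝ → ℝ → ℝ → ℝ → ℝ}
    {V W : ℝ × ℝ × ℝ × ℝ → ℝ × ℝ × ℝ × ℝ} (hA : ActsAs A V) (hB : ActsAs B W)
    (hV : Differentiable ℝ V) (hW : Differentiable ℝ W) {F : ℝ → ℝ → ℝ → ℝ → ℝ}
    (hF : ContDiff ℝ 2 (uncurry₄ F)) (t x y u : ℝ) :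
    A (B F) t x y u - B (A F) t x y u
      = fderiv ℝ (uncurry₄ F) (t, x, y, u) (VectorField.lieBracket ℝ V W (t, x, y, u)) := by
  have hd : Differentiable ℝ (uncurry₄ F) := hF.differentiable (by norm_num)
  have hd' : Differentiable ℝ (fderiv ℝ (uncurry₄ F)) :=
    (hF.fderiv_right (m := 1) (by norm_num)).differentiable (by norm_num)
  have eA : uncurry₄ (A F) = fun q => fderiv ℝ (uncurry₄ F) q (V q) := funext (hA F hd)
  have eB : uncurry₄ (B F) = fun q => fderiv ℝ (uncurry₄ F) q (W q) := funext (hB F hd)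
  have hAB := hA (B F) (eB ▸ hd'.clm_apply hW) (t, x, y, u)
  have hBA := hB (A F) (eA ▸ hd'.clm_apply hV) (t, x, y, u)
  rw [← fderiv_fderiv_apply_sub_eq_lieBracket hF hV hW, ← eA, ← eB, ← hAB, ← hBA]
  rfl

theorem fderiv_uncurry₄_apply {F : ℝ → ℝ → ℝ → ℝ → ℝ} (hF : Differentiable ℝ (uncurry₄ F))
    (t x y u a b c d : ℝ) :
    fderiv ℝ (uncurry₄ F) (t, x, y, u) (a, b, c, d)
      = a * pdt F t x y u + b * pdx F t x y u + c * pdy F t x y u + d * pdu F t x y u := by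
  have h := (hF (t, x, y, u)).hasFDerivAt
  have lt : HasDerivAt (fun s : ℝ => (s, x, y, u)) (1, 0, 0, 0) t :=
    (hasDerivAt_id t).prodMk (hasDerivAt_const t (x, y, u))
  have lx : HasDerivAt (fun s : ℝ => (t, s, y, u)) (0, 1, 0, 0) x :=
    (hasDerivAt_const x t).prodMk ((hasDerivAt_id x).prodMk (hasDerivAt_const x (y, u)))
  have ly : HasDerivAt (fun s : ℝ => (t, x, s, u)) (0, 0, 1, 0) y :=
    (hasDerivAt_const y t).prodMk
      ((hasDerivAt_const y x).prodMk ((hasDerivAt_id y).prodMk (hasDerivAt_const y u)))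
  have lu : HasDerivAt (fun s : ℝ => (t, x, y, s)) (0, 0, 0, 1) u :=
    (hasDerivAt_const u t).prodMk
      ((hasDerivAt_const u x).prodMk ((hasDerivAt_const u y).prodMk (hasDerivAt_id u)))
  have ht : pdt F t x y u = fderiv ℝ (uncurry₄ F) (t, x, y, u) (1, 0, 0, 0) :=
    (HasFDerivAt.comp_hasDerivAt (l := uncurry₄ F) (f := fun s => (s, x, y, u)) t h lt).deriv
  have hx : pdx F t x y u = fderiv ℝ (uncurry₄ F) (t, x, y, u) (0, 1, 0, 0) :=
    (HasFDerivAt.comp_hasDerivAt (l := uncurry₄ F) (f := fun s => (t, s, y, u)) x h lx).deriv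
  have hy : pdy F t x y u = fderiv ℝ (uncurry₄ F) (t, x, y, u) (0, 0, 1, 0) :=
    (HasFDerivAt.comp_hasDerivAt (l := uncurry₄ F) (f := fun s => (t, x, s, u)) y h ly).deriv
  have hu : pdu F t x y u = fderiv ℝ (uncurry₄ F) (t, x, y, u) (0, 0, 0, 1) :=
    (HasFDerivAt.comp_hasDerivAt (l := uncurry₄ F) (f := fun s => (t, x, y, s)) u h lu).deriv
  have e : ((a, b, c, d) : ℝ × ℝ × ℝ × ℝ) = a • (1, 0, 0, 0) + b • (0, 1, 0, 0)
      + c • (0, 0, 1, 0) + d • (0, 0, 0, 1) := by simp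
  rw [ht, hx, hy, hu, e]
  simp only [map_add, map_smul, smul_eq_mul]

/-- The vector field of `𝒫ᵗ`. -/
def fieldPt (_ : ℝ × ℝ × ℝ × ℝ) : ℝ × ℝ × ℝ × ℝ := (1, 0, 0, 0)

/-- The vector field of `𝒟`. -/
def fieldD (p : ℝ × ℝ × ℝ × ℝ) : ℝ × ℝ × ℝ × ℝ :=
  (2 * p.1, p.2.1, 3 * p.2.2.1, -(2 * p.2.2.2))

/-- The vector field of `𝒦`. -/
def fieldK (p : ℝ × ℝ × ℝ × ℝ) : ℝ × ℝ × ℝ × ℝ :=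
  (p.1 ^ 2, p.1 * p.2.1 + 3 * p.2.2.1, 3 * p.1 * p.2.2.1, -((p.2.1 ^ 2 + 2 * p.1) * p.2.2.2))

/-- The vector field of `𝒫³`. -/
def fieldP3 (p : ℝ × ℝ × ℝ × ℝ) : ℝ × ℝ × ℝ × ℝ :=
  (0, 3 * p.1 ^ 2, p.1 ^ 3, 3 * (p.2.2.1 - p.1 * p.2.1) * p.2.2.2)

/-- The vector field of `𝒫²`. -/
def fieldP2 (p : ℝ × ℝ × ℝ × ℝ) : ℝ × ℝ × ℝ × ℝ :=
  (0, 2 * p.1, p.1 ^ 2, -(p.2.1 * p.2.2.2))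

/-- The vector field of `𝒫¹`. -/
def fieldP1 (p : ℝ × ℝ × ℝ × ℝ) : ℝ × ℝ × ℝ × ℝ := (0, 1, p.1, 0)

/-- The vector field of `𝒫⁰`. -/
def fieldP0 (_ : ℝ × ℝ × ℝ × ℝ) : ℝ × ℝ × ℝ × ℝ := (0, 0, 1, 0)

theorem actsAs_opPt : ActsAs opPt fieldPt := by
  rintro F hF ⟨t, x, y, u⟩
  simp only [fieldPt, fderiv_uncurry₄_apply hF, uncurry₄, opPt]
  ring

theorem actsAs_opD : ActsAs opD fieldD := by
  rintro F hF ⟨t, x, y, u⟩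
  simp only [fieldD, fderiv_uncurry₄_apply hF, uncurry₄, opD]
  ring

theorem actsAs_opK : ActsAs opK fieldK := by
  rintro F hF ⟨t, x, y, u⟩
  simp only [fieldK, fderiv_uncurry₄_apply hF, uncurry₄, opK]
  ring

theorem actsAs_opP3 : ActsAs opP3 fieldP3 := by
  rintro F hF ⟨t, x, y, u⟩
  simp only [fieldP3, fderiv_uncurry₄_apply hF, uncurry₄, opP3]
  ring

theorem actsAs_opP2 : ActsAs opP2 fieldP2 := by
  rintro F hF ⟨t, x, y, u⟩
  simp only [fieldP2, fderiv_uncurry₄_apply hF, uncurry₄, opP2]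
  ring

theorem actsAs_opP1 : ActsAs opP1 fieldP1 := by
  rintro F hF ⟨t, x, y, u⟩
  simp only [fieldP1, fderiv_uncurry₄_apply hF, uncurry₄, opP1]
  ring

theorem actsAs_opP0 : ActsAs opP0 fieldP0 := by
  rintro F hF ⟨t, x, y, u⟩
  simp only [fieldP0, fderiv_uncurry₄_apply hF, uncurry₄, opP0]
  ring

theorem differentiable_fieldPt : Differentiable ℝ fieldPt := by unfold fieldPt; fun_prop

theorem differentiable_fieldD : Differentiable ℝ fieldD := by unfold fieldD; fun_prop

theorem differentiable_fieldK : Differentiable ℝ fieldK := by unfold fieldK; fun_prop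

theorem differentiable_fieldP3 : Differentiable ℝ fieldP3 := by unfold fieldP3; fun_prop

theorem differentiable_fieldP2 : Differentiable ℝ fieldP2 := by unfold fieldP2; fun_prop

theorem differentiable_fieldP1 : Differentiable ℝ fieldP1 := by unfold fieldP1; fun_prop

theorem differentiable_fieldP0 : Differentiable ℝ fieldP0 := by unfold fieldP0; fun_prop

/-- The derivative of a differentiable map in a direction is its derivative along a line. -/
theorem fderiv_apply_eq_of_hasDerivAt {V : ℝ × ℝ × ℝ × ℝ → ℝ × ℝ × ℝ × ℝ}
    (hV : Differentiable ℝ V) {t x y u a b c d : ℝ} {w : ℝ × ℝ × ℝ × ℝ}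
    (h : HasDerivAt (fun s : ℝ => V (t + s * a, x + s * b, y + s * c, u + s * d)) w 0) :
    fderiv ℝ V (t, x, y, u) (a, b, c, d) = w := by
  have hl := (hV (t, x, y, u)).lineDeriv_eq_fderiv (v := (a, b, c, d))
  rw [← hl, lineDeriv]
  simpa using h.deriv

theorem fderiv_fieldPt (t x y u a b c d : ℝ) :
    fderiv ℝ fieldPt (t, x, y, u) (a, b, c, d) = (0, 0, 0, 0) :=
  fderiv_apply_eq_of_hasDerivAt differentiable_fieldPt (hasDerivAt_const _ _)

theorem hasDerivAt_add_mul_const (x a : ℝ) : HasDerivAt (fun s : ℝ => x + s * a) a 0 := by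
  simpa using ((hasDerivAt_id (0 : ℝ)).mul_const a).const_add x

theorem fderiv_fieldD (t x y u a b c d : ℝ) :
    fderiv ℝ fieldD (t, x, y, u) (a, b, c, d) = (2 * a, b, 3 * c, -(2 * d)) :=
  fderiv_apply_eq_of_hasDerivAt differentiable_fieldD
    (((hasDerivAt_add_mul_const t a).const_mul 2).prodMk
      ((hasDerivAt_add_mul_const x b).prodMk
        (((hasDerivAt_add_mul_const y c).const_mul 3).prodMk
          ((hasDerivAt_add_mul_const u d).const_mul 2).neg)))

theorem fderiv_fieldK (t x y u a b c d : ℝ) :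
    fderiv ℝ fieldK (t, x, y, u) (a, b, c, d)
      = (2 * t * a, a * x + t * b + 3 * c, 3 * (a * y + t * c),
        -((2 * x * b + 2 * a) * u + (x ^ 2 + 2 * t) * d)) := by
  have ht := hasDerivAt_add_mul_const t a
  have hx := hasDerivAt_add_mul_const x b
  have hy := hasDerivAt_add_mul_const y c
  have hu := hasDerivAt_add_mul_const u d
  refine fderiv_apply_eq_of_hasDerivAt differentiable_fieldK (HasDerivAt.congr_deriv
    ((ht.pow 2).prodMk (((ht.mul hx).add (hy.const_mul 3)).prodMk
    (((ht.const_mul 3).mul hy).prodMk (((hx.pow 2).add (ht.const_mul 2)).mul hu).neg))) ?_)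
  simp only [Prod.mk.injEq, Pi.add_apply, Pi.pow_apply]
  refine ⟨?_, ?_, ?_, ?_⟩ <;> norm_num
  ring

theorem fderiv_fieldP3 (t x y u a b c d : ℝ) :
    fderiv ℝ fieldP3 (t, x, y, u) (a, b, c, d)
      = (0, 6 * t * a, 3 * t ^ 2 * a,
        3 * ((c - (a * x + t * b)) * u + (y - t * x) * d)) := by
  have ht := hasDerivAt_add_mul_const t a
  have hx := hasDerivAt_add_mul_const x b
  have hy := hasDerivAt_add_mul_const y c
  have hu := hasDerivAt_add_mul_const u d
  refine fderiv_apply_eq_of_hasDerivAt differentiable_fieldP3 (HasDerivAt.congr_deriv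
    ((hasDerivAt_const (0 : ℝ) (0 : ℝ)).prodMk (((ht.pow 2).const_mul 3).prodMk
    ((ht.pow 3).prodMk (((hy.sub (ht.mul hx)).const_mul 3).mul hu)))) ?_)
  simp only [Prod.mk.injEq, Pi.sub_apply, Pi.mul_apply]
  refine ⟨?_, ?_, ?_, ?_⟩ <;> norm_num <;> ring

theorem fderiv_fieldP2 (t x y u a b c d : ℝ) :
    fderiv ℝ fieldP2 (t, x, y, u) (a, b, c, d)
      = (0, 2 * a, 2 * t * a, -(b * u + x * d)) := by
  have ht := hasDerivAt_add_mul_const t a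
  have hx := hasDerivAt_add_mul_const x b
  have hu := hasDerivAt_add_mul_const u d
  refine fderiv_apply_eq_of_hasDerivAt differentiable_fieldP2 (HasDerivAt.congr_deriv
    ((hasDerivAt_const (0 : ℝ) (0 : ℝ)).prodMk ((ht.const_mul 2).prodMk
    ((ht.pow 2).prodMk (hx.mul hu).neg))) ?_)
  simp

theorem fderiv_fieldP1 (t x y u a b c d : ℝ) :
    fderiv ℝ fieldP1 (t, x, y, u) (a, b, c, d) = (0, 0, a, 0) :=
  fderiv_apply_eq_of_hasDerivAt differentiable_fieldP1
    ((hasDerivAt_const _ _).prodMk ((hasDerivAt_const _ _).prodMk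
      ((hasDerivAt_add_mul_const t a).prodMk (hasDerivAt_const _ _))))

theorem fderiv_fieldP0 (t x y u a b c d : ℝ) :
    fderiv ℝ fieldP0 (t, x, y, u) (a, b, c, d) = (0, 0, 0, 0) :=
  fderiv_apply_eq_of_hasDerivAt differentiable_fieldP0 (hasDerivAt_const _ _)

theorem commutation_relations_of_essential_algebra
    (F : ℝ → ℝ → ℝ → ℝ → ℝ)
    (hF : ContDiff ℝ 2 (fun p : ℝ × ℝ × ℝ × ℝ => F p.1 p.2.1 p.2.2.1 p.2.2.2)) :
    ∀ t x y u : ℝ,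
      opPt (opD F) t x y u - opD (opPt F) t x y u = 2 * opPt F t x y u ∧
      opPt (opK F) t x y u - opK (opPt F) t x y u = opD F t x y u ∧
      opD (opK F) t x y u - opK (opD F) t x y u = 2 * opK F t x y u ∧
      opP1 (opP2 F) t x y u - opP2 (opP1 F) t x y u = -(opI F t x y u) ∧
      opP0 (opP3 F) t x y u - opP3 (opP0 F) t x y u = 3 * opI F t x y u := by
  intro t x y u
  have hd : Differentiable ℝ (uncurry₄ F) := ContDiff.differentiable hF (by norm_num)
  refine ⟨?_, ?_, ?_, ?_, ?_⟩
  · rw [actsAs_opPt.commutator actsAs_opD differentiable_fieldPt differentiable_fieldD hF]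
    simp only [VectorField.lieBracket, fieldPt, fieldD, fderiv_fieldPt, fderiv_fieldD,
      Prod.mk_sub_mk, fderiv_uncurry₄_apply hd, opPt]
    ring
  · rw [actsAs_opPt.commutator actsAs_opK differentiable_fieldPt differentiable_fieldK hF]
    simp only [VectorField.lieBracket, fieldPt, fieldK, fderiv_fieldPt, fderiv_fieldK,
      Prod.mk_sub_mk, fderiv_uncurry₄_apply hd, opD]
    ring
  · rw [actsAs_opD.commutator actsAs_opK differentiable_fieldD differentiable_fieldK hF]
    simp only [VectorField.lieBracket, fieldD, fieldK, fderiv_fieldD, fderiv_fieldK,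
      Prod.mk_sub_mk, fderiv_uncurry₄_apply hd, opK]
    ring
  · rw [actsAs_opP1.commutator actsAs_opP2 differentiable_fieldP1 differentiable_fieldP2 hF]
    simp only [VectorField.lieBracket, fieldP1, fieldP2, fderiv_fieldP1, fderiv_fieldP2,
      Prod.mk_sub_mk, fderiv_uncurry₄_apply hd, opI]
    ring
  · rw [actsAs_opP0.commutator actsAs_opP3 differentiable_fieldP0 differentiable_fieldP3 hF]
    simp only [VectorField.lieBracket, fieldP0, fieldP3, fderiv_fieldP0, fderiv_fieldP3,
      Prod.mk_sub_mk, fderiv_uncurry₄_apply hd, opI]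
    ring

end
end

section
/- Fix real constants t′, x′, y′. The function F(t,x,y) := (√3 / (2π(t−t′)²)) · exp( −(x−x′)²/(4(t−t′)) − 3( y − y′ − ½(x+x′)(t−t′) )² / (t−t′)³ ) is a solution of the remarkable Fokker–Planck equation u_t + x u_y = u_xx on the open set {(t,x,y) ∈ ℝ³ : t > t′}. -/
/-- Kolmogorov's fundamental solution of the remarkable Fokker--Planck equation. -/
noncomputable def kolmogorovFundSol (t' x' y' : ℝ) (t x y : ℝ) : ℝ :=
  (Real.sqrt 3 / (2 * Real.pi * (t - t') ^ 2)) *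
    Real.exp (-(x - x') ^ 2 / (4 * (t - t'))
      - 3 * (y - y' - (1 / 2) * (x + x') * (t - t')) ^ 2 / (t - t') ^ 3)

theorem kolmogorovFundSol_contDiffOn (t' x' y' : ℝ) {n : WithTop ℕ∞} :
    ContDiffOn ℝ n
      (fun p : ℝ × ℝ × ℝ => kolmogorovFundSol t' x' y' p.1 p.2.1 p.2.2)
      {p : ℝ × ℝ × ℝ | t' < p.1} := by
  intro p hp
  have hs : p.1 - t' ≠ 0 := sub_ne_zero.mpr (ne_of_gt hp)
  have hpi := Real.pi_ne_zero
  apply ContDiffAt.contDiffWithinAt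
  unfold kolmogorovFundSol
  refine (contDiffAt_const.div (by fun_prop) (by positivity)).mul
    (ContDiffAt.exp (ContDiffAt.sub ?_ ?_))
  · exact ContDiffAt.div (by fun_prop) (by fun_prop) (by positivity)
  · exact ContDiffAt.div (by fun_prop) (by fun_prop) (by positivity)

theorem hasDerivAt_kolmogorovFundSol_t (t' x' y' x y : ℝ) {t : ℝ} (ht : t ≠ t') :
    HasDerivAt (fun s => kolmogorovFundSol t' x' y' s x y)
      (kolmogorovFundSol t' x' y' t x y *
        (-2 / (t - t') + (x - x') ^ 2 / (4 * (t - t') ^ 2)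
          + 3 * (x + x') * (y - y' - (1 / 2) * (x + x') * (t - t')) / (t - t') ^ 3
          + 9 * (y - y' - (1 / 2) * (x + x') * (t - t')) ^ 2 / (t - t') ^ 4)) t := by
  have hs : t - t' ≠ 0 := sub_ne_zero.mpr ht
  have hpi := Real.pi_ne_zero
  have h : HasDerivAt (fun s : ℝ => s - t') 1 t := (hasDerivAt_id t).sub_const t'
  have hw := (h.const_mul ((1 / 2) * (x + x'))).const_sub (y - y')
  have hE := ((hasDerivAt_const t (-(x - x') ^ 2)).fun_div (h.const_mul 4) (by positivity)).fun_sub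
    (((hw.fun_pow 2).const_mul 3).fun_div (h.fun_pow 3) (by positivity))
  have hC := (hasDerivAt_const t (Real.sqrt 3)).fun_div ((h.fun_pow 2).const_mul (2 * Real.pi))
    (by positivity)
  refine (hC.fun_mul hE.exp).congr_deriv ?_
  unfold kolmogorovFundSol
  generalize Real.exp _ = e
  field_simp
  ring

theorem hasDerivAt_kolmogorovFundSol_y (t' x' y' t x y : ℝ) :
    HasDerivAt (fun s => kolmogorovFundSol t' x' y' t x s)
      (kolmogorovFundSol t' x' y' t x y *
        (-6 * (y - y' - (1 / 2) * (x + x') * (t - t')) / (t - t') ^ 3)) y := by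
  have hw := ((hasDerivAt_id' y).sub_const y').sub_const ((1 / 2) * (x + x') * (t - t'))
  have hE := (((hw.fun_pow 2).const_mul 3).div_const ((t - t') ^ 3)).const_sub
    (-(x - x') ^ 2 / (4 * (t - t')))
  refine (hE.exp.const_mul (Real.sqrt 3 / (2 * Real.pi * (t - t') ^ 2))).congr_deriv ?_
  unfold kolmogorovFundSol
  generalize Real.exp _ = e
  ring

theorem hasDerivAt_kolmogorovFundSol_x (t' x' y' x y : ℝ) {t : ℝ} (ht : t ≠ t') :
    HasDerivAt (fun s => kolmogorovFundSol t' x' y' t s y)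
      (kolmogorovFundSol t' x' y' t x y *
        (-(x - x') / (2 * (t - t'))
          + 3 * (y - y' - (1 / 2) * (x + x') * (t - t')) / (t - t') ^ 2)) x := by
  have hs : t - t' ≠ 0 := sub_ne_zero.mpr ht
  have hpi := Real.pi_ne_zero
  have ha := (hasDerivAt_id' x).sub_const x'
  have hw := ((((hasDerivAt_id' x).add_const x').const_mul (1 / 2)).mul_const
    (t - t')).const_sub (y - y')
  have hE := ((ha.fun_pow 2).fun_neg.div_const (4 * (t - t'))).fun_sub
    (((hw.fun_pow 2).const_mul 3).div_const ((t - t') ^ 3))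
  refine (hE.exp.const_mul (Real.sqrt 3 / (2 * Real.pi * (t - t') ^ 2))).congr_deriv ?_
  unfold kolmogorovFundSol
  generalize Real.exp _ = e
  field_simp
  ring

theorem dXX_kolmogorovFundSol (t' x' y' x y : ℝ) {t : ℝ} (ht : t ≠ t') :
    dXX (kolmogorovFundSol t' x' y') t x y =
      kolmogorovFundSol t' x' y' t x y *
        ((-(x - x') / (2 * (t - t'))
          + 3 * (y - y' - (1 / 2) * (x + x') * (t - t')) / (t - t') ^ 2) ^ 2
          - 2 / (t - t')) := by
  have hs : t - t' ≠ 0 := sub_ne_zero.mpr ht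
  have ha := (hasDerivAt_id' x).sub_const x'
  have hw := ((((hasDerivAt_id' x).add_const x').const_mul (1 / 2)).mul_const
    (t - t')).const_sub (y - y')
  have hE := (ha.fun_neg.div_const (2 * (t - t'))).fun_add
    ((hw.const_mul 3).div_const ((t - t') ^ 2))
  unfold dXX
  rw [show deriv (fun s => kolmogorovFundSol t' x' y' t s y) = _ from
    funext fun z => (hasDerivAt_kolmogorovFundSol_x t' x' y' z y ht).deriv,
    ((hasDerivAt_kolmogorovFundSol_x t' x' y' x y ht).fun_mul hE).deriv]
  field_simp
  ring

theorem kolmogorov_fundamental_solution (t' x' y' : ℝ) :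
    ContDiffOn ℝ 2
      (fun p : ℝ × ℝ × ℝ => kolmogorovFundSol t' x' y' p.1 p.2.1 p.2.2)
      {p : ℝ × ℝ × ℝ | t' < p.1} ∧
    ∀ t x y : ℝ, t' < t →
      dT (kolmogorovFundSol t' x' y') t x y
        + x * dY (kolmogorovFundSol t' x' y') t x y
        = dXX (kolmogorovFundSol t' x' y') t x y := by
  refine ⟨kolmogorovFundSol_contDiffOn t' x' y', fun t x y ht => ?_⟩
  have hs : t - t' ≠ 0 := sub_ne_zero.mpr ht.ne'
  rw [dXX_kolmogorovFundSol t' x' y' x y ht.ne', dT, dY,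
    (hasDerivAt_kolmogorovFundSol_t t' x' y' x y ht.ne').deriv,
    (hasDerivAt_kolmogorovFundSol_y t' x' y' t x y).deriv]
  field_simp
  ring
end

section
/- Let w : ℝ² → ℝ be a C² function satisfying z₂ · ∂_{z₁}w(z₁,z₂) = ∂²_{z₂}w(z₁,z₂) − 3z₁·w(z₁,z₂) for all (z₁,z₂) ∈ ℝ². Then the function u(t,x,y) := exp( (3/10)·t·(t⁴ − 5tx + 10y) ) · w( y − ¼t⁴, x − t³ ) is a solution of the remarkable Fokker–Planck equation u_t + x u_y = u_xx on all of ℝ³. -/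
/-- ∂_{z₁} w -/
noncomputable def d1 (w : ℝ → ℝ → ℝ) (z1 z2 : ℝ) : ℝ := deriv (fun s => w s z2) z1
/-- ∂²_{z₂} w -/
noncomputable def d22 (w : ℝ → ℝ → ℝ) (z1 z2 : ℝ) : ℝ := deriv (deriv (fun s => w z1 s)) z2

/-- The chain rule along a curve, in terms of the two partial derivatives. -/
theorem hasDerivAt_comp_curve {w : ℝ → ℝ → ℝ}
    (hw : Differentiable ℝ (fun p : ℝ × ℝ => w p.1 p.2)) {a b : ℝ → ℝ} {a' b' s : ℝ}
    (ha : HasDerivAt a a' s) (hb : HasDerivAt b b' s) :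
    HasDerivAt (fun r => w (a r) (b r))
      (a' * d1 w (a s) (b s) + b' * deriv (w (a s)) (b s)) s := by
  have hF := (hw (a s, b s)).hasFDerivAt
  have hfst : HasDerivAt (fun r => w r (b s))
      (fderiv ℝ (fun p : ℝ × ℝ => w p.1 p.2) (a s, b s) (1, 0)) (a s) :=
    HasFDerivAt.comp_hasDerivAt (f := fun r => (r, b s)) (a s) hF
      ((hasDerivAt_id (a s)).prodMk (hasDerivAt_const (a s) (b s)))
  have hsnd : HasDerivAt (w (a s))
      (fderiv ℝ (fun p : ℝ × ℝ => w p.1 p.2) (a s, b s) (0, 1)) (b s) :=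
    HasFDerivAt.comp_hasDerivAt (f := fun r => (a s, r)) (b s) hF
      ((hasDerivAt_const (b s) (a s)).prodMk (hasDerivAt_id (b s)))
  have hcurve : HasDerivAt (fun r => w (a r) (b r))
      (fderiv ℝ (fun p : ℝ × ℝ => w p.1 p.2) (a s, b s) (a', b')) s :=
    HasFDerivAt.comp_hasDerivAt (f := fun r => (a r, b r)) s hF (ha.prodMk hb)
  rw [d1, hfst.deriv, hsnd.deriv]
  refine hcurve.congr_deriv ?_
  have hsplit : ((a', b') : ℝ × ℝ) = a' • ((1, 0) : ℝ × ℝ) + b' • ((0, 1) : ℝ × ℝ) := by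
    ext <;> simp
  rw [hsplit, map_add, map_smul, map_smul, smul_eq_mul, smul_eq_mul]

/-- The second derivative of the product of the exponential of an affine function with a
translate of a `C²` function. -/
theorem deriv_deriv_exp_mul_comp_sub {g : ℝ → ℝ} (hg : ContDiff ℝ 2 g) {E : ℝ → ℝ} {k : ℝ}
    (hE : ∀ s, HasDerivAt E k s) (c x : ℝ) :
    deriv (deriv (fun s => Real.exp (E s) * g (s - c))) x =
      Real.exp (E x) *
        (k ^ 2 * g (x - c) + 2 * k * deriv g (x - c) + deriv (deriv g) (x - c)) := by
  have hg₁ : Differentiable ℝ g := hg.differentiable (by norm_num)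
  have hg₂ : Differentiable ℝ (deriv g) :=
    (hg.deriv' (n := 1)).differentiable (by norm_num)
  have hfirst : deriv (fun s => Real.exp (E s) * g (s - c)) =
      fun s => Real.exp (E s) * (k * g (s - c) + deriv g (s - c)) := by
    funext s
    refine ((hE s).exp.mul ((hg₁ (s - c)).hasDerivAt.comp_sub_const s c)).deriv.trans ?_
    ring
  rw [hfirst]
  refine ((hE x).exp.mul ((((hg₁ (x - c)).hasDerivAt.comp_sub_const x c).const_mul k).add
    ((hg₂ (x - c)).hasDerivAt.comp_sub_const x c))).deriv.trans ?_
  simp only [Pi.add_apply]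
  ring

theorem lie_reduction_1_1 (w : ℝ → ℝ → ℝ)
    (hw : ContDiff ℝ 2 (fun p : ℝ × ℝ => w p.1 p.2))
    (hred : ∀ z1 z2 : ℝ, z2 * d1 w z1 z2 = d22 w z1 z2 - 3 * z1 * w z1 z2) :
    ContDiff ℝ 2 (fun p : ℝ × ℝ × ℝ =>
      Real.exp ((3 / 10) * p.1 * (p.1 ^ 4 - 5 * p.1 * p.2.1 + 10 * p.2.2)) *
        w (p.2.2 - p.1 ^ 4 / 4) (p.2.1 - p.1 ^ 3)) ∧
    ∀ t x y : ℝ,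
      dT (fun t x y => Real.exp ((3 / 10) * t * (t ^ 4 - 5 * t * x + 10 * y)) *
            w (y - t ^ 4 / 4) (x - t ^ 3)) t x y
        + x * dY (fun t x y => Real.exp ((3 / 10) * t * (t ^ 4 - 5 * t * x + 10 * y)) *
            w (y - t ^ 4 / 4) (x - t ^ 3)) t x y
        = dXX (fun t x y => Real.exp ((3 / 10) * t * (t ^ 4 - 5 * t * x + 10 * y)) *
            w (y - t ^ 4 / 4) (x - t ^ 3)) t x y := by
  refine ⟨?_, fun t x y => ?_⟩
  · have hz : ContDiff ℝ 2 (fun p : ℝ × ℝ × ℝ =>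
        ((p.2.2 - p.1 ^ 4 / 4, p.2.1 - p.1 ^ 3) : ℝ × ℝ)) := by fun_prop
    exact ContDiff.mul (by fun_prop) (hw.comp hz)
  · have hd : Differentiable ℝ (fun p : ℝ × ℝ => w p.1 p.2) := hw.differentiable (by norm_num)
    have hsec : ContDiff ℝ 2 (w (y - t ^ 4 / 4)) :=
      hw.comp (contDiff_const.prodMk contDiff_id)
    have hEt : HasDerivAt (fun s : ℝ => (3 / 10) * s * (s ^ 4 - 5 * s * x + 10 * y))
        (3 / 2 * t ^ 4 - 3 * t * x + 3 * y) t := by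
      refine HasDerivAt.congr_deriv (((hasDerivAt_id t).const_mul (3 / 10 : ℝ)).mul
        (((hasDerivAt_pow 4 t).sub (((hasDerivAt_id t).const_mul 5).mul_const x)).add_const
          (10 * y))) ?_
      simp
      ring
    have hEy : HasDerivAt (fun s : ℝ => (3 / 10) * t * (t ^ 4 - 5 * t * x + 10 * s))
        (3 * t) y := by
      refine HasDerivAt.congr_deriv
        ((((hasDerivAt_id y).const_mul 10).const_add (t ^ 4 - 5 * t * x)).const_mul
        ((3 / 10) * t)) ?_
      ring
    have hEx : ∀ r, HasDerivAt (fun s : ℝ => (3 / 10) * t * (t ^ 4 - 5 * t * s + 10 * y))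
        (-(3 / 2) * t ^ 2) r := fun r => by
      refine HasDerivAt.congr_deriv
        (((((hasDerivAt_id r).const_mul (5 * t)).const_sub (t ^ 4)).add_const
        (10 * y)).const_mul ((3 / 10) * t)) ?_
      ring
    have ha : HasDerivAt (fun s : ℝ => y - s ^ 4 / 4) (-t ^ 3) t := by
      refine HasDerivAt.congr_deriv (((hasDerivAt_pow 4 t).div_const 4).const_sub y) ?_
      norm_num
    have hb : HasDerivAt (fun s : ℝ => x - s ^ 3) (-(3 * t ^ 2)) t := by
      simpa using (hasDerivAt_pow 3 t).const_sub x
    have hwt := hasDerivAt_comp_curve hd ha hb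
    have hwy := hasDerivAt_comp_curve hd ((hasDerivAt_id y).sub_const (t ^ 4 / 4))
      (hasDerivAt_const y (x - t ^ 3))
    have hut := (hEt.exp.mul hwt).deriv
    have huy := (hEy.exp.mul hwy).deriv
    have huxx := deriv_deriv_exp_mul_comp_sub hsec hEx (t ^ 3) x
    have hr := hred (y - t ^ 4 / 4) (x - t ^ 3)
    simp only [d22] at hr
    simp only [dT, dY, dXX]
    refine (congrArg₂ (fun p q => p + x * q) hut huy).trans (Eq.trans ?_ huxx.symm)
    simp only [id]
    linear_combination
      Real.exp ((3 / 10) * t * (t ^ 4 - 5 * t * x + 10 * y)) * hr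
end

section
/- Let ν ∈ ℝ and let w : ℝ² → ℝ be a C² function satisfying (2z₂ − 3z₁)·∂_{z₁}w = 2∂²_{z₂}w + z₂·∂_{z₂}w − (ν−2)·w for all (z₁,z₂) ∈ ℝ². Then the function u(t,x,y) := t^{ν/2 − 1} · w( t^{−3/2} y, t^{−1/2} x ) is a solution of the remarkable Fokker–Planck equation u_t + x u_y = u_xx on the open set {(t,x,y) ∈ ℝ³ : t > 0}. -/
/-- ∂_{z₂} w -/
noncomputable def d2 (w : ℝ → ℝ → ℝ) (z1 z2 : ℝ) : ℝ := deriv (fun s => w z1 s) z2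
/-- The ansatz of reduction 1.3 (with ε′ = 1). -/
noncomputable def sol5 (ν : ℝ) (w : ℝ → ℝ → ℝ) (t x y : ℝ) : ℝ :=
  t ^ (ν / 2 - 1) * w (t ^ (-(3 : ℝ) / 2) * y) (t ^ (-(1 : ℝ) / 2) * x)

/-- Chain rule for a function of two real variables along a differentiable curve. -/
theorem HasDerivAt.comp_two_of_differentiableAt {w : ℝ → ℝ → ℝ} {f g : ℝ → ℝ} {f' g' t : ℝ}
    (hw : DifferentiableAt ℝ (fun p : ℝ × ℝ => w p.1 p.2) (f t, g t))
    (hf : HasDerivAt f f' t) (hg : HasDerivAt g g' t) :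
    HasDerivAt (fun s => w (f s) (g s)) (f' * d1 w (f t) (g t) + g' * d2 w (f t) (g t)) t := by
  obtain ⟨L, hL⟩ := hw
  have h1 : d1 w (f t) (g t) = L (1, 0) :=
    (hL.comp_hasDerivAt (f := fun s => (s, g t)) (f t)
      ((hasDerivAt_id' (f t)).prodMk (hasDerivAt_const (f t) (g t)))).deriv
  have h2 : d2 w (f t) (g t) = L (0, 1) :=
    (hL.comp_hasDerivAt (f := fun s => (f t, s)) (g t)
      ((hasDerivAt_const (g t) (f t)).prodMk (hasDerivAt_id' (g t)))).deriv
  have h : (f', g') = f' • ((1, 0) : ℝ × ℝ) + g' • ((0, 1) : ℝ × ℝ) := by simp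
  have h3 : L (f', g') = f' * d1 w (f t) (g t) + g' * d2 w (f t) (g t) := by
    rw [h, map_add, map_smul, map_smul, h1, h2, smul_eq_mul, smul_eq_mul]
  rw [← h3]
  exact hL.comp_hasDerivAt t (hf.prodMk hg)

theorem contDiffOn_sol5 (ν : ℝ) {w : ℝ → ℝ → ℝ} {n : WithTop ℕ∞}
    (hw : ContDiff ℝ n (fun p : ℝ × ℝ => w p.1 p.2)) :
    ContDiffOn ℝ n (fun p : ℝ × ℝ × ℝ => sol5 ν w p.1 p.2.1 p.2.2)
      {p : ℝ × ℝ × ℝ | 0 < p.1} := by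
  have hpow (a : ℝ) :
      ContDiffOn ℝ n (fun p : ℝ × ℝ × ℝ => p.1 ^ a) {p : ℝ × ℝ × ℝ | 0 < p.1} :=
    contDiffOn_fst.rpow_const_of_ne fun p hp => ne_of_gt hp
  have hx : ContDiff ℝ n (fun p : ℝ × ℝ × ℝ => p.2.1) := contDiff_fst.comp contDiff_snd
  have hy : ContDiff ℝ n (fun p : ℝ × ℝ × ℝ => p.2.2) := contDiff_snd.comp contDiff_snd
  exact (hpow _).mul
    (hw.comp_contDiffOn (((hpow _).mul hy.contDiffOn).prodMk ((hpow _).mul hx.contDiffOn)))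

theorem dT_sol5 (ν : ℝ) {w : ℝ → ℝ → ℝ} (hw : Differentiable ℝ (fun p : ℝ × ℝ => w p.1 p.2))
    {t : ℝ} (ht : 0 < t) (x y : ℝ) :
    dT (sol5 ν w) t x y =
      t ^ (ν / 2 - 1) * t⁻¹ *
        ((ν / 2 - 1) * w (t ^ (-(3 : ℝ) / 2) * y) (t ^ (-(1 : ℝ) / 2) * x)
          - 3 / 2 * (t ^ (-(3 : ℝ) / 2) * y)
            * d1 w (t ^ (-(3 : ℝ) / 2) * y) (t ^ (-(1 : ℝ) / 2) * x)
          - 1 / 2 * (t ^ (-(1 : ℝ) / 2) * x)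
            * d2 w (t ^ (-(3 : ℝ) / 2) * y) (t ^ (-(1 : ℝ) / 2) * x)) := by
  have hpow (a : ℝ) : HasDerivAt (fun s : ℝ => s ^ a) (a * (t ^ a * t⁻¹)) t := by
    have h := Real.hasDerivAt_rpow_const (p := a) (Or.inl ht.ne')
    rwa [Real.rpow_sub_one ht.ne', div_eq_mul_inv] at h
  have h := (hpow (ν / 2 - 1)).mul (HasDerivAt.comp_two_of_differentiableAt (hw _)
    ((hpow (-(3 : ℝ) / 2)).mul_const y) ((hpow (-(1 : ℝ) / 2)).mul_const x))
  refine h.deriv.trans ?_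
  ring

theorem dY_sol5 (ν : ℝ) (w : ℝ → ℝ → ℝ) (t x y : ℝ) :
    dY (sol5 ν w) t x y = t ^ (ν / 2 - 1) *
      (t ^ (-(3 : ℝ) / 2) * d1 w (t ^ (-(3 : ℝ) / 2) * y) (t ^ (-(1 : ℝ) / 2) * x)) := by
  simp only [dY, sol5, d1, deriv_const_mul_field]
  rw [deriv_comp_mul_left (t ^ (-(3 : ℝ) / 2)) (fun s => w s (t ^ (-(1 : ℝ) / 2) * x)) y,
    smul_eq_mul]

theorem dXX_sol5 (ν : ℝ) (w : ℝ → ℝ → ℝ) (t x y : ℝ) :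
    dXX (sol5 ν w) t x y = t ^ (ν / 2 - 1) * ((t ^ (-(1 : ℝ) / 2)) ^ 2 *
      d22 w (t ^ (-(3 : ℝ) / 2) * y) (t ^ (-(1 : ℝ) / 2) * x)) := by
  have h : deriv (fun s => sol5 ν w t s y) = fun s => t ^ (ν / 2 - 1) * (t ^ (-(1 : ℝ) / 2) *
      deriv (fun r => w (t ^ (-(3 : ℝ) / 2) * y) r) (t ^ (-(1 : ℝ) / 2) * s)) := by
    funext s
    simp only [sol5, deriv_const_mul_field]
    rw [deriv_comp_mul_left (t ^ (-(1 : ℝ) / 2)) (fun r => w (t ^ (-(3 : ℝ) / 2) * y) r) s,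
      smul_eq_mul]
  simp only [dXX, d22, h, deriv_const_mul_field]
  rw [deriv_comp_mul_left (t ^ (-(1 : ℝ) / 2)) (deriv fun r => w (t ^ (-(3 : ℝ) / 2) * y) r) x,
    smul_eq_mul]
  ring

theorem lie_reduction_1_3 (ν : ℝ) (w : ℝ → ℝ → ℝ)
    (hw : ContDiff ℝ 2 (fun p : ℝ × ℝ => w p.1 p.2))
    (hred : ∀ z1 z2 : ℝ,
      (2 * z2 - 3 * z1) * d1 w z1 z2
        = 2 * d22 w z1 z2 + z2 * d2 w z1 z2 - (ν - 2) * w z1 z2) :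
    ContDiffOn ℝ 2 (fun p : ℝ × ℝ × ℝ => sol5 ν w p.1 p.2.1 p.2.2)
      {p : ℝ × ℝ × ℝ | 0 < p.1} ∧
    ∀ t x y : ℝ, 0 < t →
      dT (sol5 ν w) t x y + x * dY (sol5 ν w) t x y = dXX (sol5 ν w) t x y := by
  refine ⟨contDiffOn_sol5 ν hw, fun t x y ht => ?_⟩
  rw [dT_sol5 ν (hw.differentiable two_ne_zero) ht, dY_sol5, dXX_sol5]
  have h3 : t ^ (-(3 : ℝ) / 2) = t⁻¹ * t ^ (-(1 : ℝ) / 2) := by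
    rw [← Real.rpow_neg_one, ← Real.rpow_add ht]
    norm_num
  have h2 : (t ^ (-(1 : ℝ) / 2)) ^ 2 = t⁻¹ := by
    rw [← Real.rpow_mul_natCast ht.le, ← Real.rpow_neg_one]
    norm_num
  have h := hred (t ^ (-(3 : ℝ) / 2) * y) (t ^ (-(1 : ℝ) / 2) * x)
  rw [h2]
  rw [h3] at h ⊢
  linear_combination (t ^ (ν / 2 - 1) * t⁻¹ / 2) * h
end

section
/- Let ε ∈ {−1, 1} and let w : ℝ² → ℝ be a C² solution of the (1+1)-dimensional linear heat equation ∂_{z₁}w = ∂²_{z₂}w on ℝ². Then the function u(t,x,y) := t^{−1/2} · exp(−x²/(4t)) · w( t³/3 + 2εt − 1/t, 2y − (t + ε/t)x ) is a solution of the remarkable Fokker–Planck equation u_t + x u_y = u_xx on the open set {(t,x,y) ∈ ℝ³ : t > 0}. -/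
/-- The ansatz of reduction 1.5. -/
noncomputable def sol6 (ε : ℝ) (w : ℝ → ℝ → ℝ) (t x y : ℝ) : ℝ :=
  t ^ (-(1 : ℝ) / 2) * Real.exp (-x ^ 2 / (4 * t)) *
    w (t ^ 3 / 3 + 2 * ε * t - 1 / t) (2 * y - (t + ε / t) * x)

lemma hasDerivAt_comp_pair {w : ℝ → ℝ → ℝ} (hw : Differentiable ℝ (fun p : ℝ × ℝ => w p.1 p.2))
    {f g : ℝ → ℝ} {f' g' s : ℝ} (hf : HasDerivAt f f' s) (hg : HasDerivAt g g' s) :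
    HasDerivAt (fun r => w (f r) (g r))
      (f' * d1 w (f s) (g s) + g' * deriv (fun r => w (f s) r) (g s)) s := by
  have hW := (hw (f s, g s)).hasFDerivAt
  have h1 : d1 w (f s) (g s) = fderiv ℝ (fun p : ℝ × ℝ => w p.1 p.2) (f s, g s) (1, 0) :=
    (HasFDerivAt.comp_hasDerivAt (f s) (f := fun r => (r, g s)) hW
      ((hasDerivAt_id (f s)).prodMk (hasDerivAt_const (f s) (g s)))).deriv
  have h2 : deriv (fun r => w (f s) r) (g s) =
      fderiv ℝ (fun p : ℝ × ℝ => w p.1 p.2) (f s, g s) (0, 1) :=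
    (HasFDerivAt.comp_hasDerivAt (g s) (f := fun r => (f s, r)) hW
      ((hasDerivAt_const (g s) (f s)).prodMk (hasDerivAt_id (g s)))).deriv
  have h := HasFDerivAt.comp_hasDerivAt s (f := fun r => (f r, g r)) hW (hf.prodMk hg)
  have hsplit : ((f', g') : ℝ × ℝ) = f' • ((1, 0) : ℝ × ℝ) + g' • ((0, 1) : ℝ × ℝ) := by
    simp
  rw [hsplit, map_add, map_smul, map_smul, ← h1, ← h2] at h
  exact h

lemma hasDerivAt_exp_neg_sq_div (t x : ℝ) (ht : t ≠ 0) :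
    HasDerivAt (fun s => Real.exp (-s ^ 2 / (4 * t)))
      (Real.exp (-x ^ 2 / (4 * t)) * (-x / (2 * t))) x := by
  have h := ((((hasDerivAt_id x).pow 2).neg).div_const (4 * t)).exp
  refine h.congr_deriv ?_
  simp
  field_simp
  norm_num
  ring

lemma contDiffOn_sol6 (ε : ℝ) {w : ℝ → ℝ → ℝ} (hw : ContDiff ℝ 2 (fun p : ℝ × ℝ => w p.1 p.2)) :
    ContDiffOn ℝ 2 (fun p : ℝ × ℝ × ℝ => sol6 ε w p.1 p.2.1 p.2.2)
      {p : ℝ × ℝ × ℝ | 0 < p.1} := by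
  intro p hp
  have hp0 : p.1 ≠ 0 := ne_of_gt hp
  have hp4 : 4 * p.1 ≠ 0 := mul_ne_zero four_ne_zero hp0
  have hz : ContDiffAt ℝ 2 (fun p : ℝ × ℝ × ℝ =>
      ((p.1 ^ 3 / 3 + 2 * ε * p.1 - 1 / p.1, 2 * p.2.2 - (p.1 + ε / p.1) * p.2.1) : ℝ × ℝ)) p := by
    fun_prop (disch := assumption)
  have hA : ContDiffAt ℝ 2 (fun p : ℝ × ℝ × ℝ => p.1 ^ (-(1 : ℝ) / 2)) p :=
    contDiffAt_fst.rpow_const_of_ne hp0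
  have hE : ContDiffAt ℝ 2 (fun p : ℝ × ℝ × ℝ => Real.exp (-p.2.1 ^ 2 / (4 * p.1))) p := by
    fun_prop (disch := assumption)
  exact ((hA.mul hE).mul (hw.contDiffAt.comp p hz)).contDiffWithinAt

lemma dT_sol6 (ε : ℝ) {w : ℝ → ℝ → ℝ} (hw : Differentiable ℝ (fun p : ℝ × ℝ => w p.1 p.2))
    {t : ℝ} (ht : 0 < t) (x y z1 z2 : ℝ) (hz1 : z1 = t ^ 3 / 3 + 2 * ε * t - 1 / t)
    (hz2 : z2 = 2 * y - (t + ε / t) * x) :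
    dT (sol6 ε w) t x y = t ^ (-(1 : ℝ) / 2) * Real.exp (-x ^ 2 / (4 * t)) *
      ((-1 / (2 * t) + x ^ 2 / (4 * t ^ 2)) * w z1 z2 + (t ^ 2 + 2 * ε + 1 / t ^ 2) * d1 w z1 z2
        - (1 - ε / t ^ 2) * x * deriv (fun r => w z1 r) z2) := by
  subst hz1 hz2
  have ht0 : t ≠ 0 := ht.ne'
  have hA : HasDerivAt (fun s : ℝ => s ^ (-(1 : ℝ) / 2))
      (t ^ (-(1 : ℝ) / 2) * (-1 / (2 * t))) t := by
    refine (Real.hasDerivAt_rpow_const (Or.inl ht0)).congr_deriv ?_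
    rw [Real.rpow_sub_one ht0]
    field_simp
  have hE : HasDerivAt (fun s : ℝ => Real.exp (-x ^ 2 / (4 * s)))
      (Real.exp (-x ^ 2 / (4 * t)) * (x ^ 2 / (4 * t ^ 2))) t := by
    have h := (((hasDerivAt_const t (-x ^ 2)).fun_div ((hasDerivAt_id' t).const_mul 4)
      (mul_ne_zero four_ne_zero ht0))).exp
    refine h.congr_deriv ?_
    field_simp
    ring
  have h1 : HasDerivAt (fun s : ℝ => s ^ 3 / 3 + 2 * ε * s - 1 / s)
      (t ^ 2 + 2 * ε + 1 / t ^ 2) t := by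
    have h := ((((hasDerivAt_id' t).fun_pow 3).div_const 3).fun_add
      ((hasDerivAt_id' t).const_mul (2 * ε))).fun_sub
      ((hasDerivAt_const t (1 : ℝ)).fun_div (hasDerivAt_id' t) ht0)
    refine h.congr_deriv ?_
    norm_num
    field_simp
    ring
  have h2 : HasDerivAt (fun s : ℝ => 2 * y - (s + ε / s) * x) (-((1 - ε / t ^ 2) * x)) t := by
    have h := (((hasDerivAt_id' t).fun_add
      ((hasDerivAt_const t ε).fun_div (hasDerivAt_id' t) ht0)).mul_const x).const_sub (2 * y)
    refine h.congr_deriv ?_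
    field_simp
    ring
  refine (((hA.fun_mul hE).fun_mul (hasDerivAt_comp_pair hw h1 h2)).deriv).trans ?_
  ring

lemma dY_sol6 (ε : ℝ) {w : ℝ → ℝ → ℝ} (hw : Differentiable ℝ (fun p : ℝ × ℝ => w p.1 p.2))
    (t x y z1 z2 : ℝ) (hz1 : z1 = t ^ 3 / 3 + 2 * ε * t - 1 / t)
    (hz2 : z2 = 2 * y - (t + ε / t) * x) :
    dY (sol6 ε w) t x y = t ^ (-(1 : ℝ) / 2) * Real.exp (-x ^ 2 / (4 * t)) *
      (2 * deriv (fun r => w z1 r) z2) := by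
  subst hz1 hz2
  have h2 := ((hasDerivAt_id' y).const_mul 2).sub_const ((t + ε / t) * x)
  refine (((hasDerivAt_comp_pair hw (hasDerivAt_const y (t ^ 3 / 3 + 2 * ε * t - 1 / t))
    h2).const_mul (t ^ (-(1 : ℝ) / 2) * Real.exp (-x ^ 2 / (4 * t)))).deriv).trans ?_
  ring

lemma dXX_sol6 (ε : ℝ) {w : ℝ → ℝ → ℝ} (hw : ContDiff ℝ 2 (fun p : ℝ × ℝ => w p.1 p.2))
    {t : ℝ} (ht : 0 < t) (x y z1 z2 : ℝ) (hz1 : z1 = t ^ 3 / 3 + 2 * ε * t - 1 / t)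
    (hz2 : z2 = 2 * y - (t + ε / t) * x) :
    dXX (sol6 ε w) t x y = t ^ (-(1 : ℝ) / 2) * Real.exp (-x ^ 2 / (4 * t)) *
      ((-1 / (2 * t) + x ^ 2 / (4 * t ^ 2)) * w z1 z2
        + x / t * (t + ε / t) * deriv (fun r => w z1 r) z2 + (t + ε / t) ^ 2 * d22 w z1 z2) := by
  have ht0 : t ≠ 0 := ht.ne'
  have hg : ContDiff ℝ 2 (fun r => w z1 r) := hw.comp (contDiff_prodMk_right z1)
  have hg' : Differentiable ℝ (deriv (fun r => w z1 r)) :=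
    ((contDiff_succ_iff_deriv (n := 1)).1 hg).2.2.differentiable one_ne_zero
  have hlin (s : ℝ) : HasDerivAt (fun r : ℝ => 2 * y - (t + ε / t) * r) (-(t + ε / t)) s := by
    simpa using ((hasDerivAt_id' s).const_mul (t + ε / t)).const_sub (2 * y)
  have hw1 (s : ℝ) := HasDerivAt.comp s
    ((hg.differentiable two_ne_zero) (2 * y - (t + ε / t) * s)).hasDerivAt (hlin s)
  have hw2 (s : ℝ) := HasDerivAt.comp s (hg' (2 * y - (t + ε / t) * s)).hasDerivAt (hlin s)
  have hE (s : ℝ) := (hasDerivAt_exp_neg_sq_div t s ht0).const_mul (t ^ (-(1 : ℝ) / 2))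
  have hfirst : deriv (fun s => sol6 ε w t s y) = fun s =>
      t ^ (-(1 : ℝ) / 2) * (Real.exp (-s ^ 2 / (4 * t)) * (-s / (2 * t))) *
        w z1 (2 * y - (t + ε / t) * s) +
      t ^ (-(1 : ℝ) / 2) * Real.exp (-s ^ 2 / (4 * t)) *
        (deriv (fun r => w z1 r) (2 * y - (t + ε / t) * s) * -(t + ε / t)) := by
    funext s
    subst hz1
    exact ((hE s).fun_mul (hw1 s)).deriv
  have hB : HasDerivAt (fun s : ℝ => -s / (2 * t)) (-1 / (2 * t)) x :=
    (hasDerivAt_id' x).fun_neg.div_const (2 * t)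
  have h := (((((hasDerivAt_exp_neg_sq_div t x ht0).fun_mul hB).const_mul
    (t ^ (-(1 : ℝ) / 2))).fun_mul (hw1 x)).fun_add
    ((hE x).fun_mul ((hw2 x).mul_const (-(t + ε / t))))).deriv
  rw [dXX, hfirst, d22]
  refine h.trans ?_
  simp only [Function.comp_apply, ← hz2]
  field_simp
  ring

theorem lie_reduction_1_5 (ε : ℝ) (hε : ε = -1 ∨ ε = 1) (w : ℝ → ℝ → ℝ)
    (hw : ContDiff ℝ 2 (fun p : ℝ × ℝ => w p.1 p.2))
    (hheat : ∀ z1 z2 : ℝ, d1 w z1 z2 = d22 w z1 z2) :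
    ContDiffOn ℝ 2 (fun p : ℝ × ℝ × ℝ => sol6 ε w p.1 p.2.1 p.2.2)
      {p : ℝ × ℝ × ℝ | 0 < p.1} ∧
    ∀ t x y : ℝ, 0 < t →
      dT (sol6 ε w) t x y + x * dY (sol6 ε w) t x y = dXX (sol6 ε w) t x y := by
  refine ⟨contDiffOn_sol6 ε hw, fun t x y ht => ?_⟩
  have hd := hw.differentiable two_ne_zero
  have hε2 : ε ^ 2 = 1 := by rcases hε with rfl | rfl <;> norm_num
  have ht0 : t ≠ 0 := ht.ne'
  rw [dT_sol6 ε hd ht x y _ _ rfl rfl, dY_sol6 ε hd t x y _ _ rfl rfl,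
    dXX_sol6 ε hw ht x y _ _ rfl rfl, ← hheat]
  have hsq : (t + ε / t) ^ 2 = t ^ 2 + 2 * ε + 1 / t ^ 2 := by
    field_simp
    linear_combination hε2
  have hxt : x / t * (t + ε / t) = x * (1 + ε / t ^ 2) := by
    field_simp
  rw [hsq, hxt]
  ring
end

section
/- Let w : ℝ² → ℝ be a C² solution of the (1+1)-dimensional linear heat equation ∂_{z₁}w = ∂²_{z₂}w on ℝ². Then the function u(t,x,y) := w( t³/3, y − tx ) is a solution of the remarkable Fokker–Planck equation u_t + x u_y = u_xx on all of ℝ³. -/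
theorem lie_reduction_1_6 (w : ℝ → ℝ → ℝ)
    (hw : ContDiff ℝ 2 (fun p : ℝ × ℝ => w p.1 p.2))
    (hheat : ∀ z1 z2 : ℝ, d1 w z1 z2 = d22 w z1 z2) :
    ContDiff ℝ 2 (fun p : ℝ × ℝ × ℝ => w (p.1 ^ 3 / 3) (p.2.2 - p.1 * p.2.1)) ∧
    ∀ t x y : ℝ,
      dT (fun t x y => w (t ^ 3 / 3) (y - t * x)) t x y
        + x * dY (fun t x y => w (t ^ 3 / 3) (y - t * x)) t x y
        = dXX (fun t x y => w (t ^ 3 / 3) (y - t * x)) t x y := by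
  refine ⟨hw.comp (f := fun p : ℝ × ℝ × ℝ => (p.1 ^ 3 / 3, p.2.2 - p.1 * p.2.1))
    (by fun_prop), fun t x y => ?_⟩
  have hslice (c : ℝ) : ContDiff ℝ 2 (w c) :=
    hw.comp (f := fun s : ℝ => (c, s)) (by fun_prop)
  have hdiff (c z : ℝ) : HasDerivAt (w c) (deriv (w c) z) z :=
    ((hslice c).differentiable (by norm_num) z).hasDerivAt
  have hdiff₂ (c z : ℝ) : HasDerivAt (deriv (w c)) (deriv (deriv (w c)) z) z := by
    have h : ContDiff ℝ 1 (deriv (w c)) :=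
      ((contDiff_succ_iff_deriv (n := 1)).1 (by simpa [one_add_one_eq_two] using hslice c)).2.2
    exact (h.differentiable (by norm_num) z).hasDerivAt
  have haffine (s : ℝ) : HasDerivAt (fun r => y - t * r) (-t) s := by
    simpa using ((hasDerivAt_id s).const_mul t).const_sub y
  have hX : deriv (fun s => w (t ^ 3 / 3) (y - t * s)) =
      fun s => deriv (w (t ^ 3 / 3)) (y - t * s) * -t :=
    funext fun s => ((hdiff _ _).comp s (haffine s)).deriv
  have hXX : dXX (fun t x y => w (t ^ 3 / 3) (y - t * x)) t x y =
      t ^ 2 * d22 w (t ^ 3 / 3) (y - t * x) := by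
    simp only [dXX, d22, hX]
    refine (((hdiff₂ (t ^ 3 / 3) _).comp x (haffine x)).mul_const (-t)).deriv.trans ?_
    ring
  have hY : dY (fun t x y => w (t ^ 3 / 3) (y - t * x)) t x y =
      deriv (w (t ^ 3 / 3)) (y - t * x) := by
    have h := (hdiff (t ^ 3 / 3) (y - t * x)).comp y ((hasDerivAt_id y).sub_const (t * x))
    rw [mul_one] at h
    exact h.deriv
  have hT : dT (fun t x y => w (t ^ 3 / 3) (y - t * x)) t x y =
      t ^ 2 * d1 w (t ^ 3 / 3) (y - t * x) - x * deriv (w (t ^ 3 / 3)) (y - t * x) := by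
    set a := t ^ 3 / 3
    set b := y - t * x
    have hF := (hw.differentiable (by norm_num) (a, b)).hasFDerivAt
    set L := fderiv ℝ (fun p : ℝ × ℝ => w p.1 p.2) (a, b)
    have h₁ : d1 w a b = L (1, 0) :=
      (hF.comp_hasDerivAt (f := fun s : ℝ => (s, b)) a
        ((hasDerivAt_id a).prodMk (hasDerivAt_const a b))).deriv
    have h₂ : deriv (w a) b = L (0, 1) :=
      (hF.comp_hasDerivAt (f := fun s : ℝ => (a, s)) b
        ((hasDerivAt_const b a).prodMk (hasDerivAt_id b))).deriv
    have hcube : HasDerivAt (fun s : ℝ => s ^ 3 / 3) (t ^ 2) t :=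
      ((hasDerivAt_pow 3 t).div_const 3).congr_deriv (by norm_num)
    have hlin : HasDerivAt (fun s : ℝ => y - s * x) (-x) t := by
      simpa using ((hasDerivAt_id t).mul_const x).const_sub y
    have hsplit : ((t ^ 2, -x) : ℝ × ℝ) = t ^ 2 • (1, 0) + (-x) • (0, 1) := by simp
    have hcurve : dT (fun t x y => w (t ^ 3 / 3) (y - t * x)) t x y = L (t ^ 2, -x) :=
      (hF.comp_hasDerivAt (f := fun s : ℝ => (s ^ 3 / 3, y - s * x)) t
        (hcube.prodMk hlin)).deriv
    rw [hcurve, hsplit, map_add, map_smul, map_smul, h₁, h₂, smul_eq_mul, smul_eq_mul]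
    ring
  rw [hT, hY, hXX, hheat]
  ring
end

section
/- Let θ : ℝ × (0,∞) → ℝ be a C² solution of the (1+1)-dimensional linear heat equation with inverse square potential ∂_{z₁}θ = ∂²_{z₂}θ + (5/36)·z₂^{−2}·θ for all z₁ ∈ ℝ, z₂ > 0. Then the function u(t,x,y) := x^{−1/4} · θ( (9/4)y, x^{3/2} ) is a solution of the remarkable Fokker–Planck equation u_t + x u_y = u_xx on the open set {(t,x,y) ∈ ℝ³ : x > 0}. -/
/-- The solution family built from a solution of the linear heat equation with
inverse square potential (5/36) z₂⁻². -/
noncomputable def sol8 (θ : ℝ → ℝ → ℝ) (t x y : ℝ) : ℝ :=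
  x ^ (-(1 : ℝ) / 4) * θ ((9 / 4) * y) (x ^ ((3 : ℝ) / 2))

/-- Second derivative of `x ↦ x ^ (-1/4) * f (x ^ (3/2))` on the positive half-line. -/
theorem deriv_deriv_rpow_mul_comp_rpow {f : ℝ → ℝ} (hf : ContDiffOn ℝ 2 f (Set.Ioi 0))
    {x : ℝ} (hx : 0 < x) :
    deriv (deriv fun s : ℝ => s ^ (-(1 : ℝ) / 4) * f (s ^ ((3 : ℝ) / 2))) x =
      5 / 16 * x ^ (-(9 : ℝ) / 4) * f (x ^ ((3 : ℝ) / 2)) +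
        9 / 4 * x ^ ((3 : ℝ) / 4) * deriv (deriv f) (x ^ ((3 : ℝ) / 2)) := by
  have hf1 : ∀ s : ℝ, 0 < s → HasDerivAt f (deriv f s) s := fun s hs =>
    ((hf.differentiableOn (by norm_num)).differentiableAt (Ioi_mem_nhds hs)).hasDerivAt
  have hf' : ContDiffOn ℝ 1 (deriv f) (Set.Ioi 0) :=
    hf.deriv_of_isOpen isOpen_Ioi (by norm_num)
  have hf2 : ∀ s : ℝ, 0 < s → HasDerivAt (deriv f) (deriv (deriv f) s) s := fun s hs =>
    ((hf'.differentiableOn (by norm_num)).differentiableAt (Ioi_mem_nhds hs)).hasDerivAt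
  have hpow : ∀ (p s : ℝ), 0 < s → HasDerivAt (fun r : ℝ => r ^ p) (p * s ^ (p - 1)) s :=
    fun p s hs => Real.hasDerivAt_rpow_const (Or.inl hs.ne')
  have hmul : ∀ {p q r s : ℝ}, 0 < s → p + q = r → s ^ p * s ^ q = s ^ r := by
    rintro p q r s hs rfl
    exact (Real.rpow_add hs p q).symm
  have hfirst : ∀ s : ℝ, 0 < s →
      deriv (fun s : ℝ => s ^ (-(1 : ℝ) / 4) * f (s ^ ((3 : ℝ) / 2))) s =
        -1 / 4 * s ^ (-(5 : ℝ) / 4) * f (s ^ ((3 : ℝ) / 2)) +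
          3 / 2 * s ^ ((1 : ℝ) / 4) * deriv f (s ^ ((3 : ℝ) / 2)) := by
    intro s hs
    have hc := (hf1 _ (Real.rpow_pos_of_pos hs (3 / 2))).comp s (hpow (3 / 2) s hs)
    refine ((hpow (-1 / 4) s hs).mul hc).deriv.trans ?_
    have e : s ^ (-(1 : ℝ) / 4) * s ^ ((3 : ℝ) / 2 - 1) = s ^ ((1 : ℝ) / 4) :=
      hmul hs (by norm_num)
    rw [← e, show (-(1 : ℝ) / 4 - 1) = -5 / 4 by norm_num]
    simp only [Function.comp_apply]
    ring
  have hev : (deriv fun s : ℝ => s ^ (-(1 : ℝ) / 4) * f (s ^ ((3 : ℝ) / 2))) =ᶠ[nhds x]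
      fun s => -1 / 4 * s ^ (-(5 : ℝ) / 4) * f (s ^ ((3 : ℝ) / 2)) +
        3 / 2 * s ^ ((1 : ℝ) / 4) * deriv f (s ^ ((3 : ℝ) / 2)) := by
    filter_upwards [Ioi_mem_nhds hx] with s hs using hfirst s hs
  rw [hev.deriv_eq]
  have hX := Real.rpow_pos_of_pos hx (3 / 2)
  have hc1 := (hf1 _ hX).comp x (hpow (3 / 2) x hx)
  have hc2 := (hf2 _ hX).comp x (hpow (3 / 2) x hx)
  refine ((((hpow (-5 / 4) x hx).const_mul (-1 / 4)).mul hc1).add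
    (((hpow (1 / 4) x hx).const_mul (3 / 2)).mul hc2)).deriv.trans ?_
  have e1 : x ^ (-(5 : ℝ) / 4) * x ^ ((3 : ℝ) / 2 - 1) = x ^ (-(3 : ℝ) / 4) :=
    hmul hx (by norm_num)
  have e2 : x ^ ((1 : ℝ) / 4) * x ^ ((3 : ℝ) / 2 - 1) = x ^ ((3 : ℝ) / 4) :=
    hmul hx (by norm_num)
  rw [show (-(5 : ℝ) / 4 - 1) = -9 / 4 by norm_num,
    show ((1 : ℝ) / 4 - 1) = -3 / 4 by norm_num]
  simp only [Function.comp_apply]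
  linear_combination (-3 / 8 * deriv f (x ^ ((3 : ℝ) / 2))) * e1 +
    (9 / 4 * deriv (deriv f) (x ^ ((3 : ℝ) / 2))) * e2

/-- The family `sol8` inherits smoothness from the function it is built from. -/
theorem contDiffOn_sol8 {θ : ℝ → ℝ → ℝ}
    (hθ : ContDiffOn ℝ 2 (fun p : ℝ × ℝ => θ p.1 p.2) {p : ℝ × ℝ | 0 < p.2}) :
    ContDiffOn ℝ 2 (fun p : ℝ × ℝ × ℝ => sol8 θ p.1 p.2.1 p.2.2)
      {p : ℝ × ℝ × ℝ | 0 < p.2.1} := by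
  have hpow : ∀ q : ℝ, ContDiffOn ℝ 2 (fun p : ℝ × ℝ × ℝ => p.2.1 ^ q)
      {p : ℝ × ℝ × ℝ | 0 < p.2.1} := fun q =>
    ContDiffOn.rpow_const_of_ne (by fun_prop) fun p hp => ne_of_gt hp
  have hy : ContDiffOn ℝ 2 (fun p : ℝ × ℝ × ℝ => (9 / 4 : ℝ) * p.2.2)
      {p : ℝ × ℝ × ℝ | 0 < p.2.1} := by fun_prop
  exact (hpow _).mul
    (hθ.comp (hy.prodMk (hpow (3 / 2))) fun p hp => Real.rpow_pos_of_pos hp _)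

theorem solutions_from_inverse_square_potential (θ : ℝ → ℝ → ℝ)
    (hθ : ContDiffOn ℝ 2 (fun p : ℝ × ℝ => θ p.1 p.2) {p : ℝ × ℝ | 0 < p.2})
    (hsol : ∀ z1 z2 : ℝ, 0 < z2 →
      d1 θ z1 z2 = d22 θ z1 z2 + (5 / 36) * z2 ^ (-(2 : ℤ)) * θ z1 z2) :
    ContDiffOn ℝ 2 (fun p : ℝ × ℝ × ℝ => sol8 θ p.1 p.2.1 p.2.2)
      {p : ℝ × ℝ × ℝ | 0 < p.2.1} ∧
    ∀ t x y : ℝ, 0 < x →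
      dT (sol8 θ) t x y + x * dY (sol8 θ) t x y = dXX (sol8 θ) t x y := by
  refine ⟨contDiffOn_sol8 hθ, fun t x y hx => ?_⟩
  have hX : 0 < x ^ ((3 : ℝ) / 2) := Real.rpow_pos_of_pos hx _
  have hsec : ContDiffOn ℝ 2 (fun s => θ (9 / 4 * y) s) (Set.Ioi 0) :=
    hθ.comp (f := fun s : ℝ => ((9 / 4 * y : ℝ), s)) (by fun_prop) fun s hs => hs
  have hT : dT (sol8 θ) t x y = 0 := by simp [dT, sol8]
  have hY : dY (sol8 θ) t x y =
      x ^ (-(1 : ℝ) / 4) * (9 / 4 * d1 θ (9 / 4 * y) (x ^ ((3 : ℝ) / 2))) := by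
    simp only [dY, sol8, d1, deriv_const_mul_field]
    rw [deriv_comp_mul_left (9 / 4) (fun s => θ s (x ^ ((3 : ℝ) / 2))) y, smul_eq_mul]
  have hXX : dXX (sol8 θ) t x y =
      5 / 16 * x ^ (-(9 : ℝ) / 4) * θ (9 / 4 * y) (x ^ ((3 : ℝ) / 2)) +
        9 / 4 * x ^ ((3 : ℝ) / 4) * d22 θ (9 / 4 * y) (x ^ ((3 : ℝ) / 2)) :=
    deriv_deriv_rpow_mul_comp_rpow hsec hx
  have e1 : x * x ^ (-(1 : ℝ) / 4) = x ^ ((3 : ℝ) / 4) := by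
    rw [← Real.rpow_one_add' hx.le (by norm_num)]
    norm_num
  have e2 : x ^ ((3 : ℝ) / 4) * (x ^ ((3 : ℝ) / 2)) ^ (-(2 : ℤ)) = x ^ (-(9 : ℝ) / 4) := by
    rw [← Real.rpow_intCast, ← Real.rpow_mul hx.le, ← Real.rpow_add hx]
    norm_num
  rw [hT, hY, hXX, hsol _ _ hX, ← e2, ← e1]
  ring
end

section
/- Let μ ∈ ℝ and let φ : ℝ → ℝ be a C² function satisfying 9ω·φ''(ω) + (ω + 6)·φ'(ω) = (μ − 2)·φ(ω) for all ω ∈ ℝ. Then the function u(t,x,y) := y^{μ−2} · φ( x³/y ) is a solution of the remarkable Fokker–Planck equation u_t + x u_y = u_xx on the open set {(t,x,y) ∈ ℝ³ : y > 0}. -/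
set_option linter.unusedVariables false

/-- The ansatz of reduction 2.1. -/
noncomputable def sol9 (μ : ℝ) (φ : ℝ → ℝ) (t x y : ℝ) : ℝ :=
  y ^ (μ - 2) * φ (x ^ 3 / y)

theorem contDiffOn_sol9 {n : WithTop ℕ∞} (μ : ℝ) {φ : ℝ → ℝ} (hφ : ContDiff ℝ n φ) :
    ContDiffOn ℝ n (fun p : ℝ × ℝ × ℝ => sol9 μ φ p.1 p.2.1 p.2.2)
      {p : ℝ × ℝ × ℝ | 0 < p.2.2} := by
  have hx : ContDiff ℝ n (fun p : ℝ × ℝ × ℝ => p.2.1) := contDiff_fst.comp contDiff_snd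
  have hy : ContDiff ℝ n (fun p : ℝ × ℝ × ℝ => p.2.2) := contDiff_snd.comp contDiff_snd
  exact (hy.contDiffOn.rpow_const_of_ne fun p hp => ne_of_gt hp).mul
    (hφ.comp_contDiffOn ((hx.pow 3).contDiffOn.div hy.contDiffOn fun p hp => ne_of_gt hp))

theorem dT_sol9 (μ : ℝ) (φ : ℝ → ℝ) (t x y : ℝ) : dT (sol9 μ φ) t x y = 0 :=
  deriv_const t _

theorem dY_sol9 (μ : ℝ) {φ : ℝ → ℝ} (hφ : Differentiable ℝ φ) (t x : ℝ) {y : ℝ} (hy : 0 < y) :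
    dY (sol9 μ φ) t x y =
      y ^ (μ - 2) / y * ((μ - 2) * φ (x ^ 3 / y) - x ^ 3 / y * deriv φ (x ^ 3 / y)) := by
  have hpow : HasDerivAt (fun s : ℝ => s ^ (μ - 2)) ((μ - 2) * y ^ (μ - 2 - 1)) y :=
    Real.hasDerivAt_rpow_const (Or.inl hy.ne')
  have harg : HasDerivAt (fun s : ℝ => x ^ 3 / s) (-x ^ 3 / y ^ 2) y := by
    simpa using (hasDerivAt_const y (x ^ 3)).fun_div (hasDerivAt_id' y) hy.ne'
  refine (hpow.mul ((hφ _).hasDerivAt.comp y harg)).deriv.trans ?_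
  rw [Real.rpow_sub_one hy.ne']
  simp only [Function.comp_apply]
  field_simp
  ring

theorem hasDerivAt_cube_div (x y : ℝ) :
    HasDerivAt (fun s : ℝ => s ^ 3 / y) (3 * x ^ 2 / y) x := by
  simpa using (hasDerivAt_pow 3 x).div_const y

theorem dXX_sol9 (μ : ℝ) {φ : ℝ → ℝ} (hφ : Differentiable ℝ φ)
    (hφ' : Differentiable ℝ (deriv φ)) (t x : ℝ) {y : ℝ} (hy : y ≠ 0) :
    dXX (sol9 μ φ) t x y =
      y ^ (μ - 2) / y * x *
        (9 * (x ^ 3 / y) * deriv (deriv φ) (x ^ 3 / y) + 6 * deriv φ (x ^ 3 / y)) := by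
  have hfirst : deriv (fun s => sol9 μ φ t s y) =
      fun s => y ^ (μ - 2) * (deriv φ (s ^ 3 / y) * (3 * s ^ 2 / y)) := by
    funext s
    exact (((hφ _).hasDerivAt.comp s (hasDerivAt_cube_div s y)).const_mul _).deriv
  have hsq : HasDerivAt (fun s : ℝ => 3 * s ^ 2 / y) (3 * (2 * x) / y) x := by
    simpa using ((hasDerivAt_pow 2 x).const_mul 3).div_const y
  rw [dXX, hfirst]
  refine ((((hφ' _).hasDerivAt.comp x (hasDerivAt_cube_div x y)).mul hsq).const_mul _).deriv.trans ?_
  simp only [Function.comp_apply]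
  field_simp
  ring

theorem lie_reduction_2_1 (μ : ℝ) (φ : ℝ → ℝ) (hφ : ContDiff ℝ 2 φ)
    (hred : ∀ ω : ℝ,
      9 * ω * deriv (deriv φ) ω + (ω + 6) * deriv φ ω = (μ - 2) * φ ω) :
    ContDiffOn ℝ 2 (fun p : ℝ × ℝ × ℝ => sol9 μ φ p.1 p.2.1 p.2.2)
      {p : ℝ × ℝ × ℝ | 0 < p.2.2} ∧
    ∀ t x y : ℝ, 0 < y →
      dT (sol9 μ φ) t x y + x * dY (sol9 μ φ) t x y = dXX (sol9 μ φ) t x y := by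
  refine ⟨contDiffOn_sol9 μ hφ, fun t x y hy => ?_⟩
  have hφ₁ : Differentiable ℝ φ := hφ.differentiable two_ne_zero
  have hφ₂ : Differentiable ℝ (deriv φ) := by
    have h : ContDiff ℝ (1 + 1) φ := by simpa only [one_add_one_eq_two] using hφ
    exact h.deriv'.differentiable one_ne_zero
  rw [dT_sol9, dY_sol9 μ hφ₁ t x hy, dXX_sol9 μ hφ₁ hφ₂ t x hy.ne']
  linear_combination -(y ^ (μ - 2) / y * x) * hred (x ^ 3 / y)
end

section
/- Let μ ∈ ℝ and let φ : ℝ → ℝ be a C² function satisfying 2φ''(ω) = (μ − 2)·φ(ω) − 3ω·φ'(ω) for all ω ∈ ℝ. Then the function u(t,x,y) := t^{μ/2 − 1} · φ( t^{−3/2}(y − tx) ) is a solution of the remarkable Fokker–Planck equation u_t + x u_y = u_xx on the open set {(t,x,y) ∈ ℝ³ : t > 0}. -/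
/-- The ansatz of reduction 2.4 (with ε′ = 1). -/
noncomputable def sol11 (μ : ℝ) (φ : ℝ → ℝ) (t x y : ℝ) : ℝ :=
  t ^ (μ / 2 - 1) * φ (t ^ (-(3 : ℝ) / 2) * (y - t * x))

theorem lie_reduction_2_4 (μ : ℝ) (φ : ℝ → ℝ) (hφ : ContDiff ℝ 2 φ)
    (hred : ∀ ω : ℝ,
      2 * deriv (deriv φ) ω = (μ - 2) * φ ω - 3 * ω * deriv φ ω) :
    ContDiffOn ℝ 2 (fun p : ℝ × ℝ × ℝ => sol11 μ φ p.1 p.2.1 p.2.2)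
      {p : ℝ × ℝ × ℝ | 0 < p.1} ∧
    ∀ t x y : ℝ, 0 < t →
      dT (sol11 μ φ) t x y + x * dY (sol11 μ φ) t x y = dXX (sol11 μ φ) t x y := by
  constructor
  · have hrpow : ∀ r : ℝ, ContDiffOn ℝ 2 (fun p : ℝ × ℝ × ℝ => p.1 ^ r)
        {p : ℝ × ℝ × ℝ | 0 < p.1} := fun r =>
      contDiff_fst.contDiffOn.rpow_const_of_ne fun p hp => ne_of_gt hp
    have harg : ContDiffOn ℝ 2 (fun p : ℝ × ℝ × ℝ => p.2.2 - p.1 * p.2.1)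
        {p : ℝ × ℝ × ℝ | 0 < p.1} := by
      fun_prop
    exact (hrpow _).mul (hφ.comp_contDiffOn ((hrpow _).mul harg))
  · intro t x y ht
    have hφ₁ : ∀ ω, HasDerivAt φ (deriv φ ω) ω := fun ω =>
      (hφ.differentiable (by norm_num) ω).hasDerivAt
    have hφ₂ : ∀ ω, HasDerivAt (deriv φ) (deriv (deriv φ) ω) ω := fun ω =>
      (hφ.differentiable_deriv_two ω).hasDerivAt
    have hT : dT (sol11 μ φ) t x y = _ :=
      ((Real.hasDerivAt_rpow_const (p := μ / 2 - 1) (Or.inl ht.ne')).mul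
        ((hφ₁ _).comp t ((Real.hasDerivAt_rpow_const (p := -(3 : ℝ) / 2) (Or.inl ht.ne')).mul
          (((hasDerivAt_id t).mul_const x).const_sub y)))).deriv
    have hY : dY (sol11 μ φ) t x y = _ :=
      (((hφ₁ _).comp y (((hasDerivAt_id y).sub_const (t * x)).const_mul
        (t ^ (-(3 : ℝ) / 2)))).const_mul (t ^ (μ / 2 - 1))).deriv
    have hω : ∀ z, HasDerivAt (fun s => t ^ (-(3 : ℝ) / 2) * (y - t * s))
        (t ^ (-(3 : ℝ) / 2) * -(t * 1)) z := fun z =>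
      (((hasDerivAt_id z).const_mul t).const_sub y).const_mul _
    have hX : deriv (fun s => sol11 μ φ t s y) = fun z => t ^ (μ / 2 - 1) *
        (deriv φ (t ^ (-(3 : ℝ) / 2) * (y - t * z)) * (t ^ (-(3 : ℝ) / 2) * -(t * 1))) :=
      funext fun z => (((hφ₁ _).comp z (hω z)).const_mul _).deriv
    have hXX : dXX (sol11 μ φ) t x y = t ^ (μ / 2 - 1) *
        (deriv (deriv φ) (t ^ (-(3 : ℝ) / 2) * (y - t * x)) *
          (t ^ (-(3 : ℝ) / 2) * -(t * 1)) * (t ^ (-(3 : ℝ) / 2) * -(t * 1))) := by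
      rw [dXX, hX]
      exact ((((hφ₂ _).comp x (hω x)).mul_const _).const_mul _).deriv
    have hsq : (t ^ (-(3 : ℝ) / 2)) ^ 2 * t ^ 3 = 1 := by
      rw [← Real.rpow_natCast, ← Real.rpow_mul ht.le, ← Real.rpow_natCast,
        ← Real.rpow_add ht]
      norm_num
    have hode := hred (t ^ (-(3 : ℝ) / 2) * (y - t * x))
    rw [hT, hY, hXX, Real.rpow_sub_one ht.ne' (μ / 2 - 1),
      Real.rpow_sub_one ht.ne' (-(3 : ℝ) / 2)]
    simp only [Function.comp_apply, Pi.mul_apply, id]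
    generalize t ^ (-(3 : ℝ) / 2) = c at *
    generalize t ^ (μ / 2 - 1) = b at *
    generalize hw : c * (y - t * x) = w at *
    field_simp
    linear_combination -b * hode - 2 * b * deriv (deriv φ) w * hsq - 3 * b * deriv φ w * hw
end

section
/- For every real constant C₀, the function u(t,x,y) := C₀ · (2t³ − 1)^{−1/2} · exp( −(3/2)·(y − tx)²/(2t³ − 1) ) is a solution of the remarkable Fokker–Planck equation u_t + x u_y = u_xx on the open set {(t,x,y) ∈ ℝ³ : 2t³ − 1 > 0}. -/
/-- The exact solution of reduction 2.8. -/
noncomputable def sol12 (C₀ : ℝ) (t x y : ℝ) : ℝ :=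
  C₀ * (2 * t ^ 3 - 1) ^ (-(1 : ℝ) / 2) *
    Real.exp (-(3 / 2) * (y - t * x) ^ 2 / (2 * t ^ 3 - 1))

theorem hasDerivAt_sol12_t (C₀ : ℝ) {t : ℝ} (x y : ℝ) (ht : 0 < 2 * t ^ 3 - 1) :
    HasDerivAt (fun s => sol12 C₀ s x y)
      (sol12 C₀ t x y * (-3 * t ^ 2 / (2 * t ^ 3 - 1) + 3 * (y - t * x) * x / (2 * t ^ 3 - 1) +
        9 * ((y - t * x) * t / (2 * t ^ 3 - 1)) ^ 2)) t := by
  have hD : HasDerivAt (fun s : ℝ => 2 * s ^ 3 - 1) (6 * t ^ 2) t := by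
    refine (((hasDerivAt_pow 3 t).const_mul 2).sub_const 1).congr_deriv ?_
    norm_num
    ring
  have hz : HasDerivAt (fun s : ℝ => y - s * x) (-x) t := by
    simpa using ((hasDerivAt_id t).mul_const x).const_sub y
  have hE := (((hz.pow 2).const_mul (-(3 / 2))).div hD ht.ne').exp
  have hP := (hD.rpow_const (p := -(1 : ℝ) / 2) (Or.inl ht.ne')).const_mul C₀
  refine (hP.mul hE).congr_deriv ?_
  simp only [sol12, Pi.pow_apply, Pi.div_apply, Real.rpow_sub_one ht.ne']
  field_simp
  ring

theorem hasDerivAt_sol12_y (C₀ t x y : ℝ) :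
    HasDerivAt (fun s => sol12 C₀ t x s)
      (sol12 C₀ t x y * (-3 * (y - t * x) / (2 * t ^ 3 - 1))) y := by
  have hz : HasDerivAt (fun s : ℝ => s - t * x) 1 y := (hasDerivAt_id y).sub_const _
  have hE := (((hz.pow 2).const_mul (-(3 / 2))).div_const (2 * t ^ 3 - 1)).exp
  refine (hE.const_mul (C₀ * (2 * t ^ 3 - 1) ^ (-(1 : ℝ) / 2))).congr_deriv ?_
  simp only [sol12, Pi.pow_apply]
  ring

theorem hasDerivAt_sol12_x (C₀ t x y : ℝ) :
    HasDerivAt (fun s => sol12 C₀ t s y)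
      (sol12 C₀ t x y * (3 * t * (y - t * x) / (2 * t ^ 3 - 1))) x := by
  have hz : HasDerivAt (fun s : ℝ => y - t * s) (-t) x := by
    simpa using ((hasDerivAt_id x).const_mul t).const_sub y
  have hE := (((hz.pow 2).const_mul (-(3 / 2))).div_const (2 * t ^ 3 - 1)).exp
  refine (hE.const_mul (C₀ * (2 * t ^ 3 - 1) ^ (-(1 : ℝ) / 2))).congr_deriv ?_
  simp only [sol12, Pi.pow_apply]
  ring

theorem dXX_sol12 (C₀ t x y : ℝ) :
    dXX (sol12 C₀) t x y = sol12 C₀ t x y *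
      (9 * ((y - t * x) * t / (2 * t ^ 3 - 1)) ^ 2 - 3 * t ^ 2 / (2 * t ^ 3 - 1)) := by
  have hd : deriv (fun s => sol12 C₀ t s y) =
      fun s => sol12 C₀ t s y * (3 * t * (y - t * s) / (2 * t ^ 3 - 1)) :=
    funext fun s => (hasDerivAt_sol12_x C₀ t s y).deriv
  have hz : HasDerivAt (fun s : ℝ => y - t * s) (-t) x := by
    simpa using ((hasDerivAt_id x).const_mul t).const_sub y
  rw [dXX, hd, ((hasDerivAt_sol12_x C₀ t x y).fun_mul
    ((hz.const_mul (3 * t)).div_const (2 * t ^ 3 - 1))).deriv]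
  ring

theorem contDiffOn_sol12 (C₀ : ℝ) :
    ContDiffOn ℝ 2 (fun p : ℝ × ℝ × ℝ => sol12 C₀ p.1 p.2.1 p.2.2)
      {p : ℝ × ℝ × ℝ | 0 < 2 * p.1 ^ 3 - 1} := by
  intro p hp
  have hp' : 2 * p.1 ^ 3 - 1 ≠ 0 := ne_of_gt hp
  have hD : ContDiffAt ℝ 2 (fun p : ℝ × ℝ × ℝ => 2 * p.1 ^ 3 - 1) p := by fun_prop
  have hN : ContDiffAt ℝ 2
      (fun p : ℝ × ℝ × ℝ => -(3 / 2) * (p.2.2 - p.1 * p.2.1) ^ 2) p := by fun_prop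
  exact ((contDiffAt_const.mul (hD.rpow_const_of_ne hp')).mul
    (hN.div hD hp').exp).contDiffWithinAt

theorem explicit_solution_2_8 (C₀ : ℝ) :
    ContDiffOn ℝ 2 (fun p : ℝ × ℝ × ℝ => sol12 C₀ p.1 p.2.1 p.2.2)
      {p : ℝ × ℝ × ℝ | 0 < 2 * p.1 ^ 3 - 1} ∧
    ∀ t x y : ℝ, 0 < 2 * t ^ 3 - 1 →
      dT (sol12 C₀) t x y + x * dY (sol12 C₀) t x y = dXX (sol12 C₀) t x y := by
  refine ⟨contDiffOn_sol12 C₀, fun t x y ht => ?_⟩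
  rw [dXX_sol12, dT, dY, (hasDerivAt_sol12_t C₀ x y ht).deriv, (hasDerivAt_sol12_y C₀ t x y).deriv]
  ring
end

section
/- Let γ be a nonzero real constant and let f : ℝ³ → ℝ be a smooth solution of the remarkable Fokker–Planck equation f_t + x f_y = f_xx on ℝ³. Then the function u(t,x,y) := exp( (1/16)(3γy + 2x)² + (3/2)γt ) · f( e^{γt}, e^{γt/2}·((3/2)γy + x), γ·e^{(3/2)γt}·y ) is a solution of the Kramers equation u_t + x u_y = γu_xx + γ(x − (3/4)γy)u_x + γu on all of ℝ³. -/
/-- ∂_x u -/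
noncomputable def dX (u : ℝ → ℝ → ℝ → ℝ) (t x y : ℝ) : ℝ := deriv (fun s => u t s y) x
/-- The pullback of a solution of the remarkable Fokker--Planck equation
by the transformation Φ for the Kramers equation with F(y) = -(3/4)γ²y. -/
noncomputable def sol15 (γ : ℝ) (f : ℝ → ℝ → ℝ → ℝ) (t x y : ℝ) : ℝ :=
  Real.exp ((1 / 16) * (3 * γ * y + 2 * x) ^ 2 + (3 / 2) * γ * t) *
    f (Real.exp (γ * t)) (Real.exp (γ * t / 2) * ((3 / 2) * γ * y + x))
      (γ * Real.exp ((3 / 2) * γ * t) * y)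

/-- The chain rule along a curve, in terms of the partial derivatives. -/
theorem hasDerivAt_comp_curve_s15 {f : ℝ → ℝ → ℝ → ℝ}
    (hf : Differentiable ℝ (fun p : ℝ × ℝ × ℝ => f p.1 p.2.1 p.2.2))
    {a b c : ℝ → ℝ} {a' b' c' s : ℝ}
    (ha : HasDerivAt a a' s) (hb : HasDerivAt b b' s) (hc : HasDerivAt c c' s) :
    HasDerivAt (fun s => f (a s) (b s) (c s))
      (a' * dT f (a s) (b s) (c s) + b' * dX f (a s) (b s) (c s)
        + c' * dY f (a s) (b s) (c s)) s := by
  have hF := (hf (a s, b s, c s)).hasFDerivAt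
  set L := fderiv ℝ (fun p : ℝ × ℝ × ℝ => f p.1 p.2.1 p.2.2) (a s, b s, c s)
  have comp {p q r : ℝ → ℝ} {p' q' r' z : ℝ} (hp : HasDerivAt p p' z) (hq : HasDerivAt q q' z)
      (hr : HasDerivAt r r' z) (h : (a s, b s, c s) = (p z, q z, r z)) :
      HasDerivAt (fun z => f (p z) (q z) (r z)) (L (p', q', r')) z :=
    hF.comp_hasDerivAt_of_eq z (hp.prodMk (hq.prodMk hr)) h
  have hT := comp (hasDerivAt_id' (a s)) (hasDerivAt_const _ (b s)) (hasDerivAt_const _ (c s)) rfl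
  have hX := comp (hasDerivAt_const _ (a s)) (hasDerivAt_id' (b s)) (hasDerivAt_const _ (c s)) rfl
  have hY := comp (hasDerivAt_const _ (a s)) (hasDerivAt_const _ (b s)) (hasDerivAt_id' (c s)) rfl
  have hL : L (a', b', c') = a' * L (1, 0, 0) + b' * L (0, 1, 0) + c' * L (0, 0, 1) := by
    rw [← smul_eq_mul, ← smul_eq_mul, ← smul_eq_mul, ← map_smul, ← map_smul, ← map_smul,
      ← map_add, ← map_add]
    simp
  rw [dT, dX, dY, hT.deriv, hX.deriv, hY.deriv, ← hL]
  exact comp ha hb hc rfl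

theorem hasDerivAt_dX {f : ℝ → ℝ → ℝ → ℝ}
    (hf : ContDiff ℝ 2 (fun p : ℝ × ℝ × ℝ => f p.1 p.2.1 p.2.2)) (t x y : ℝ) :
    HasDerivAt (fun s => dX f t s y) (dXX f t x y) x := by
  have h : ContDiff ℝ 2 (fun s => f t s y) :=
    hf.comp (g := fun p : ℝ × ℝ × ℝ => f p.1 p.2.1 p.2.2) (f := fun s : ℝ => (t, s, y))
      (by fun_prop)
  have h' : ContDiff ℝ 1 (deriv (fun s => f t s y)) :=
    (contDiff_succ_iff_deriv (n := 1).1 (h.of_le one_add_one_eq_two.le)).2.2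
  exact (h'.differentiable one_ne_zero x).hasDerivAt

theorem kramers_equation_34 (γ : ℝ) (hγ : γ ≠ 0) (f : ℝ → ℝ → ℝ → ℝ)
    (hf : ContDiff ℝ (⊤ : ℕ∞) (fun p : ℝ × ℝ × ℝ => f p.1 p.2.1 p.2.2))
    (hfsol : ∀ t x y : ℝ, dT f t x y + x * dY f t x y = dXX f t x y) :
    ContDiff ℝ 2 (fun p : ℝ × ℝ × ℝ => sol15 γ f p.1 p.2.1 p.2.2) ∧
    ∀ t x y : ℝ,
      dT (sol15 γ f) t x y + x * dY (sol15 γ f) t x y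
        = γ * dXX (sol15 γ f) t x y
          + γ * (x - (3 / 4) * γ * y) * dX (sol15 γ f) t x y
          + γ * sol15 γ f t x y := by
  have hf2 : ContDiff ℝ 2 (fun p : ℝ × ℝ × ℝ => f p.1 p.2.1 p.2.2) :=
    contDiff_infty.1 hf 2
  have hd := hf2.differentiable two_ne_zero
  refine ⟨?_, fun t x y => ?_⟩
  · unfold sol15
    refine ContDiff.mul (by fun_prop) ?_
    exact hf2.comp (f := fun p : ℝ × ℝ × ℝ => (Real.exp (γ * p.1),
      Real.exp (γ * p.1 / 2) * ((3 / 2) * γ * p.2.2 + p.2.1),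
      γ * Real.exp ((3 / 2) * γ * p.1) * p.2.2)) (by fun_prop)
  have lin (k s : ℝ) : HasDerivAt (fun s => k * s) k s := by
    simpa using (hasDerivAt_id s).const_mul k
  have ht := (((lin (3 / 2 * γ) t).const_add ((1 / 16) * (3 * γ * y + 2 * x) ^ 2)).exp).mul
    (hasDerivAt_comp_curve_s15 hd (lin γ t).exp
      ((((lin γ t).div_const 2).exp).mul_const ((3 / 2) * γ * y + x))
      ((((lin (3 / 2 * γ) t).exp).const_mul γ).mul_const y))
  have hy := (((((((lin (3 * γ) y).add_const (2 * x)).pow 2).const_mul (1 / 16)).add_const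
      (3 / 2 * γ * t)).exp).mul
    (hasDerivAt_comp_curve_s15 hd (hasDerivAt_const y (Real.exp (γ * t)))
      (((lin (3 / 2 * γ) y).add_const x).const_mul (Real.exp (γ * t / 2)))
      (lin (γ * Real.exp (3 / 2 * γ * t)) y)))
  have hG (x : ℝ) := ((((((lin 2 x).const_add (3 * γ * y)).pow 2).const_mul (1 / 16)).add_const
      (3 / 2 * γ * t)).exp)
  have hb (x : ℝ) := ((hasDerivAt_id' x).const_add (3 / 2 * γ * y)).const_mul
    (Real.exp (γ * t / 2))
  have hx (x : ℝ) := (hG x).mul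
    (hasDerivAt_comp_curve_s15 hd (hasDerivAt_const x (Real.exp (γ * t))) (hb x)
      (hasDerivAt_const x (γ * Real.exp (3 / 2 * γ * t) * y)))
  have hdx : deriv (fun s => sol15 γ f t s y) = fun x =>
      Real.exp ((1 / 16) * (3 * γ * y + 2 * x) ^ 2 + (3 / 2) * γ * t) *
      ((3 * γ * y + 2 * x) / 4 * f (Real.exp (γ * t))
          (Real.exp (γ * t / 2) * ((3 / 2) * γ * y + x)) (γ * Real.exp ((3 / 2) * γ * t) * y)
        + Real.exp (γ * t / 2) * dX f (Real.exp (γ * t))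
          (Real.exp (γ * t / 2) * ((3 / 2) * γ * y + x))
          (γ * Real.exp ((3 / 2) * γ * t) * y)) := by
    funext x
    refine (hx x).deriv.trans ?_
    simp only [Pi.pow_apply]
    ring
  have hxx := (hG x).mul
    (((((lin 2 x).const_add (3 * γ * y)).div_const 4).mul
      (hasDerivAt_comp_curve_s15 hd (hasDerivAt_const x (Real.exp (γ * t))) (hb x)
        (hasDerivAt_const x (γ * Real.exp (3 / 2 * γ * t) * y)))).add
      (((hasDerivAt_dX hf2 (Real.exp (γ * t)) _ (γ * Real.exp (3 / 2 * γ * t) * y)).comp x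
        (hb x)).const_mul (Real.exp (γ * t / 2))))
  have eT : dT (sol15 γ f) t x y = _ := ht.deriv
  have eY : dY (sol15 γ f) t x y = _ := hy.deriv
  have eX : dX (sol15 γ f) t x y = _ := congrFun hdx x
  have eXX : dXX (sol15 γ f) t x y = _ := (congrArg (deriv · x) hdx).trans hxx.deriv
  have hE2 : Real.exp (γ * t) = Real.exp (γ * t / 2) ^ 2 := by
    rw [← Real.exp_nat_mul]; push_cast; ring_nf
  have hE3 : Real.exp (3 / 2 * γ * t) = Real.exp (γ * t / 2) ^ 3 := by
    rw [← Real.exp_nat_mul]; push_cast; ring_nf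
  have hsol := hfsol (Real.exp (γ * t)) (Real.exp (γ * t / 2) * (3 / 2 * γ * y + x))
    (γ * Real.exp (3 / 2 * γ * t) * y)
  rw [eT, eY, eX, eXX, sol15]
  simp only [Pi.pow_apply, Pi.mul_apply, Pi.add_apply, Function.comp_apply]
  rw [← hsol]
  simp only [hE2, hE3]
  ring
end
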